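/- arXiv:math/9905157 — 2 statements merged into one kernel-verified Lean document; each statement's English description precedes it below -/
import Mathlib

section
/- Fix an integer p ≥ 3, let λ = 2cos(π/p), and let U(x) = λ − 1/x. Let α be a hyperbolic fixed point of the Hecke group G_p with Hecke conjugate α', and let (r_j), (α_j) be its partial and complete quotients. For an integer k ≥ 0, the following are equivalent: (1) the complete-quotient sequence of α is purely periodic (α_m = α_0 for some m ≥ 1) and r_0 = r_1 = ⋯ = r_{k−1} = 1 while r_k ≥ 2 (i.e. exactly k leading ones); (2) k is the smallest nonnegative integer such that 0 < α' < U^{k+2}(0) < α < U^{k+1}(0), where for k = 0 the condition reads 0 < α' < U^2(0) = λ < α (since U(0) = ∞). -/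
open Real Matrix Filter

noncomputable section

/-- `λ_p = 2 cos (π / p)`, the minimal translation length of the Hecke group `G_p`. -/
def heckeLambda (p : ℕ) : ℝ := 2 * Real.cos (Real.pi / p)

/-- The matrix `S = [[1, λ], [0, 1]]`. -/
def Smat (l : ℝ) : Matrix (Fin 2) (Fin 2) ℝ := !![1, l; 0, 1]

/-- The matrix `T = [[0, -1], [1, 0]]`. -/
def Tmat : Matrix (Fin 2) (Fin 2) ℝ := !![0, -1; 1, 0]

/-- The matrix `U = S * T = [[λ, -1], [1, 0]]`. -/
def Umat (l : ℝ) : Matrix (Fin 2) (Fin 2) ℝ := !![l, -1; 1, 0]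

/-- The matrix `S^r = [[1, rλ], [0, 1]]` for an integer exponent `r`. -/
def SmatZ (l : ℝ) (r : ℤ) : Matrix (Fin 2) (Fin 2) ℝ := !![1, (r : ℝ) * l; 0, 1]

/-- Möbius (linear fractional) action of a `2 × 2` real matrix on a real number. -/
def mobius (M : Matrix (Fin 2) (Fin 2) ℝ) (x : ℝ) : ℝ :=
  (M 0 0 * x + M 0 1) / (M 1 0 * x + M 1 1)

/-- `U^k(0)`, the image of `0` under `k` iterations of the linear fractional
transformation `U : x ↦ λ - 1/x`; as a ratio of entries of the matrix power `U^k`. -/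
def Uorbit (l : ℝ) (k : ℕ) : ℝ := ((Umat l) ^ k) 0 1 / ((Umat l) ^ k) 1 1

/-- The complete quotients `α_j` of the (negative) `λ`-continued fraction algorithm:
`α_0 = α`, `α_{j+1} = 1 / (r_j λ - α_j)` with `r_j = ⌊α_j / λ⌋ + 1`. -/
def cq (l α : ℝ) : ℕ → ℝ
  | 0 => α
  | j + 1 => 1 / (((⌊cq l α j / l⌋ : ℝ) + 1) * l - cq l α j)

/-- The partial quotients `r_j = ⌊α_j / λ⌋ + 1` of the `λ`-continued fraction of `α`. -/
def pq (l α : ℝ) (j : ℕ) : ℤ := ⌊cq l α j / l⌋ + 1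

/-- `S` as an element of `SL(2, ℝ)`. -/
def Sgen (l : ℝ) : Matrix.SpecialLinearGroup (Fin 2) ℝ :=
  ⟨!![1, l; 0, 1], by norm_num [Matrix.det_fin_two_of]⟩

/-- `T` as an element of `SL(2, ℝ)`. -/
def Tgen : Matrix.SpecialLinearGroup (Fin 2) ℝ :=
  ⟨!![0, -1; 1, 0], by norm_num [Matrix.det_fin_two_of]⟩

/-- The Hecke group `G_p`, the subgroup of `SL(2, ℝ)` generated by `S` and `T`. -/
def heckeGroup (l : ℝ) : Subgroup (Matrix.SpecialLinearGroup (Fin 2) ℝ) :=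
  Subgroup.closure {Sgen l, Tgen}

/-- `M = [[a, b], [c, d]]` fixes `α` as a linear fractional transformation, i.e.
`α` is a root of `c x² + (d - a) x - b = 0`. -/
def fixesQuad (M : Matrix.SpecialLinearGroup (Fin 2) ℝ) (α : ℝ) : Prop :=
  M.1 1 0 * α ^ 2 + (M.1 1 1 - M.1 0 0) * α - M.1 0 1 = 0

/-- `α` is a hyperbolic fixed point of the Hecke group `G(λ)`. -/
def IsHypFixedPt (l α : ℝ) : Prop :=
  ∃ M ∈ heckeGroup l, 2 < |M.1 0 0 + M.1 1 1| ∧ fixesQuad M α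

/-- `α` is a hyperbolic fixed point of `G(λ)` with Hecke conjugate `α'`
(the other root of the fixed-point quadratic). -/
def IsHypPair (l α α' : ℝ) : Prop :=
  ∃ M ∈ heckeGroup l, 2 < |M.1 0 0 + M.1 1 1| ∧ fixesQuad M α ∧ fixesQuad M α' ∧ α' ≠ α

/-- A hyperbolic fixed point is `G_p`-reduced when its complete-quotient sequence is
purely periodic. -/
def GpReduced (l β : ℝ) : Prop :=
  IsHypFixedPt l β ∧ ∃ m, 1 ≤ m ∧ cq l β m = β

/-- The map `Φ_p : [0, ∞) → [0, ∞)`: `Φ_p(x) = T U^i (x)` when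
`U^{p-i+1}(0) ≤ x < U^{p-i}(0)` for the (unique) `i` with `1 ≤ i ≤ p - 2`,
and `Φ_p(x) = x - λ` when `x ≥ λ`. -/
def Phi (p : ℕ) (l : ℝ) (x : ℝ) : ℝ :=
  @dite ℝ (∃ i : ℕ, 1 ≤ i ∧ i ≤ p - 2 ∧ Uorbit l (p - i + 1) ≤ x ∧ x < Uorbit l (p - i))
    (Classical.propDecidable _)
    (fun h => mobius (Tmat * (Umat l) ^ h.choose) x)
    (fun _ => x - l)

/-- `C_{n-j, n}`: the partial convergents computed by downward recursion,
`C_{n,n} = r_n λ` and `C_{m,n} = r_m λ - 1 / C_{m+1,n}`. -/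
def convAux (l α : ℝ) (n : ℕ) : ℕ → ℝ
  | 0 => (pq l α n : ℝ) * l
  | j + 1 => (pq l α (n - (j + 1)) : ℝ) * l - 1 / convAux l α n j

/-- The `n`-th convergent `C_n = C_{0,n}` of the `λ`-continued fraction of `α`. -/
def conv (l α : ℝ) (n : ℕ) : ℝ := convAux l α n n

/-- The word `S^{r_0} T S^{r_1} T ⋯ S^{r_n} T`. -/
def cfWord (l : ℝ) (r : ℕ → ℤ) (n : ℕ) : Matrix (Fin 2) (Fin 2) ℝ :=
  ((List.range (n + 1)).map fun j => SmatZ l (r j) * Tmat).prod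

/-- The ratio `sin (n π / p) / sin (π / p)`, which gives the entries of the powers of `U`. -/
def sinRatio (p n : ℕ) : ℝ := Real.sin (n * (Real.pi / p)) / Real.sin (Real.pi / p)

lemma sin_pi_div_pos {p : ℕ} (hp : 3 ≤ p) : 0 < Real.sin (Real.pi / p) := by
  have h : (3 : ℝ) ≤ p := by exact_mod_cast hp
  apply Real.sin_pos_of_pos_of_lt_pi (div_pos Real.pi_pos (by linarith))
  rw [div_lt_iff₀ (by linarith)]
  nlinarith [Real.pi_pos]

lemma sinRatio_zero (p : ℕ) : sinRatio p 0 = 0 := by simp [sinRatio]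

lemma sinRatio_one {p : ℕ} (hp : 3 ≤ p) : sinRatio p 1 = 1 := by
  simp [sinRatio, (sin_pi_div_pos hp).ne']

lemma sinRatio_rec (p n : ℕ) :
    sinRatio p (n + 2) = heckeLambda p * sinRatio p (n + 1) - sinRatio p n := by
  have h := Real.sin_add_sin ((n + 2 : ℕ) * (Real.pi / p)) (n * (Real.pi / p))
  have e1 : ((n + 2 : ℕ) * (Real.pi / p) + n * (Real.pi / p)) / 2
      = (n + 1 : ℕ) * (Real.pi / p) := by push_cast; ring
  have e2 : ((n + 2 : ℕ) * (Real.pi / p) - n * (Real.pi / p)) / 2 = Real.pi / p := by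
    push_cast; ring
  rw [e1, e2] at h
  unfold sinRatio heckeLambda
  rw [eq_sub_iff_add_eq, ← add_div, h]
  ring

lemma sinRatio_two {p : ℕ} (hp : 3 ≤ p) : sinRatio p 2 = heckeLambda p := by
  rw [sinRatio_rec p 0, zero_add, sinRatio_one hp, sinRatio_zero]; ring

lemma sinRatio_self {p : ℕ} (hp : 3 ≤ p) : sinRatio p p = 0 := by
  have : (p : ℝ) ≠ 0 := by positivity
  simp [sinRatio, mul_div_cancel₀ _ this]

lemma sinRatio_pred {p : ℕ} (hp : 3 ≤ p) : sinRatio p (p - 1) = 1 := by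
  have : (p : ℝ) ≠ 0 := by positivity
  have h : ((p - 1 : ℕ) : ℝ) * (Real.pi / p) = Real.pi - Real.pi / p := by
    rw [Nat.cast_sub (by omega)]; field_simp; simp
  rw [sinRatio, h, Real.sin_pi_sub, div_self (sin_pi_div_pos hp).ne']

lemma one_le_sinRatio {p n : ℕ} (hp : 3 ≤ p) (h1 : 1 ≤ n) (h2 : n + 1 ≤ p) :
    1 ≤ sinRatio p n := by
  rw [sinRatio, one_le_div (sin_pi_div_pos hp), ← sub_nonneg, Real.sin_sub_sin]
  have hp' : (0 : ℝ) < p := by positivity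
  have h1' : (1 : ℝ) ≤ n := by exact_mod_cast h1
  have h2' : (n : ℝ) + 1 ≤ p := by exact_mod_cast h2
  have hth : 0 < Real.pi / p := by positivity
  have hpt : p * (Real.pi / p) = Real.pi := mul_div_cancel₀ _ hp'.ne'
  have a1 : 0 ≤ Real.sin ((n * (Real.pi / p) - Real.pi / p) / 2) := by
    apply Real.sin_nonneg_of_nonneg_of_le_pi <;> nlinarith
  have a2 : 0 ≤ Real.cos ((n * (Real.pi / p) + Real.pi / p) / 2) := by
    apply Real.cos_nonneg_of_neg_pi_div_two_le_of_le <;> nlinarith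
  positivity

lemma sinRatio_nonneg {p n : ℕ} (hp : 3 ≤ p) (h : n ≤ p) : 0 ≤ sinRatio p n := by
  rcases Nat.eq_zero_or_pos n with rfl | h0
  · rw [sinRatio_zero]
  rcases h.eq_or_lt with rfl | h1
  · rw [sinRatio_self hp]
  · linarith [one_le_sinRatio hp h0 h1]

lemma one_le_heckeLambda {p : ℕ} (hp : 3 ≤ p) : 1 ≤ heckeLambda p := by
  rw [← sinRatio_two hp]
  exact one_le_sinRatio hp (by norm_num) hp

lemma sinRatio_sub_two {p : ℕ} (hp : 3 ≤ p) : sinRatio p (p - 2) = heckeLambda p := by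
  obtain ⟨q, rfl⟩ : ∃ q, p = q + 2 := ⟨p - 2, by omega⟩
  have h1 := sinRatio_pred hp
  have h2 := sinRatio_self hp
  have h3 := sinRatio_rec (q + 2) q
  rw [show q + 2 - 1 = q + 1 by omega] at h1
  rw [h1, h2] at h3
  rw [show q + 2 - 2 = q by omega]
  linarith

lemma sinRatio_succ_self {p : ℕ} (hp : 3 ≤ p) : sinRatio p (p + 1) = -1 := by
  obtain ⟨q, rfl⟩ : ∃ q, p = q + 1 := ⟨p - 1, by omega⟩
  have h1 := sinRatio_pred hp
  rw [show q + 1 - 1 = q by omega] at h1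
  rw [sinRatio_rec, sinRatio_self hp, h1]; ring

lemma sinRatio_det {p : ℕ} (hp : 3 ≤ p) (n : ℕ) :
    sinRatio p (n + 1) * sinRatio p (n + 1) - sinRatio p (n + 2) * sinRatio p n = 1 := by
  induction n with
  | zero => rw [zero_add, sinRatio_one hp, sinRatio_zero]; ring
  | succ n ih =>
    rw [sinRatio_rec p (n + 1)]
    rw [sinRatio_rec] at ih ⊢
    linear_combination ih

lemma Umat_pow_succ {p : ℕ} (hp : 3 ≤ p) (n : ℕ) :
    Umat (heckeLambda p) ^ (n + 1) =
      !![sinRatio p (n + 2), -sinRatio p (n + 1); sinRatio p (n + 1), -sinRatio p n] := by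
  induction n with
  | zero => simp [Umat, sinRatio_two hp, sinRatio_one hp, sinRatio_zero]
  | succ n ih =>
    rw [pow_succ', ih, Umat, sinRatio_rec p (n + 1), sinRatio_rec p n]
    ext i j
    fin_cases i <;> fin_cases j <;> simp [Matrix.mul_apply, Fin.sum_univ_two] <;> ring

lemma Umat_pow_self {p : ℕ} (hp : 3 ≤ p) : Umat (heckeLambda p) ^ p = -1 := by
  obtain ⟨q, rfl⟩ : ∃ q, p = q + 1 := ⟨p - 1, by omega⟩
  have h1 := sinRatio_pred hp
  rw [show q + 1 - 1 = q by omega] at h1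
  rw [Umat_pow_succ hp, sinRatio_self hp, h1, sinRatio_succ_self hp]
  ext i j
  fin_cases i <;> fin_cases j <;> simp

lemma Uorbit_succ {p : ℕ} (hp : 3 ≤ p) (n : ℕ) :
    Uorbit (heckeLambda p) (n + 1) = sinRatio p (n + 1) / sinRatio p n := by
  simp [Uorbit, Umat_pow_succ hp, neg_div_neg_eq]

lemma Uorbit_add_self {p : ℕ} (hp : 3 ≤ p) (n : ℕ) :
    Uorbit (heckeLambda p) (n + p) = Uorbit (heckeLambda p) n := by
  simp [Uorbit, pow_add, Umat_pow_self hp, neg_div_neg_eq]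

lemma Uorbit_two {p : ℕ} (hp : 3 ≤ p) : Uorbit (heckeLambda p) 2 = heckeLambda p := by
  rw [Uorbit_succ hp, sinRatio_one hp, sinRatio_two hp, div_one]

lemma Uorbit_self {p : ℕ} (hp : 3 ≤ p) : Uorbit (heckeLambda p) p = 0 := by
  have := Uorbit_succ hp (p - 1)
  rw [show p - 1 + 1 = p by omega, sinRatio_self hp, zero_div] at this
  exact this

lemma Uorbit_succ_self {p : ℕ} (hp : 3 ≤ p) : Uorbit (heckeLambda p) (p + 1) = 0 := by
  rw [Uorbit_succ hp, sinRatio_self hp, div_zero]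

lemma Uorbit_pred {p : ℕ} (hp : 3 ≤ p) :
    Uorbit (heckeLambda p) (p - 1) = 1 / heckeLambda p := by
  have := Uorbit_succ hp (p - 2)
  rw [show p - 2 + 1 = p - 1 by omega, sinRatio_pred hp, sinRatio_sub_two hp] at this
  exact this

lemma Uorbit_pos {p : ℕ} (hp : 3 ≤ p) {n : ℕ} (h : n + 3 ≤ p) :
    0 < Uorbit (heckeLambda p) (n + 2) := by
  rw [Uorbit_succ hp]
  have h1 := one_le_sinRatio hp (n := n + 1) (by omega) (by omega)
  have h2 := one_le_sinRatio hp (n := n + 2) (by omega) (by omega)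
  positivity

lemma Uorbit_rec {p : ℕ} (hp : 3 ≤ p) {n : ℕ} (h : n + 3 ≤ p) :
    Uorbit (heckeLambda p) (n + 3) = heckeLambda p - 1 / Uorbit (heckeLambda p) (n + 2) := by
  rw [Uorbit_succ hp, Uorbit_succ hp, sinRatio_rec]
  have h2 := one_le_sinRatio hp (n := n + 2) (by omega) (by omega)
  have : sinRatio p (n + 2) ≠ 0 := by positivity
  rw [one_div_div, sub_div, mul_div_cancel_right₀ _ this]

lemma Uorbit_succ_lt {p : ℕ} (hp : 3 ≤ p) {n : ℕ} (h : n + 3 ≤ p) :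
    Uorbit (heckeLambda p) (n + 3) < Uorbit (heckeLambda p) (n + 2) := by
  have h1 := one_le_sinRatio hp (n := n + 1) (by omega) (by omega)
  have h2 := one_le_sinRatio hp (n := n + 2) (by omega) (by omega)
  rw [Uorbit_succ hp, Uorbit_succ hp, div_lt_div_iff₀ (by positivity) (by positivity)]
  linarith [sinRatio_det hp (n + 1)]

lemma Uorbit_anti {p : ℕ} (hp : 3 ≤ p) {m n : ℕ} (hmn : m ≤ n) (h : n + 2 ≤ p) :
    Uorbit (heckeLambda p) (n + 2) ≤ Uorbit (heckeLambda p) (m + 2) := by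
  induction n, hmn using Nat.le_induction with
  | base => rfl
  | succ n _ ih => exact (Uorbit_succ_lt hp (by omega)).le.trans (ih (by omega))

lemma Uorbit_le_heckeLambda {p : ℕ} (hp : 3 ≤ p) {n : ℕ} (h : n + 2 ≤ p) :
    Uorbit (heckeLambda p) (n + 2) ≤ heckeLambda p := by
  have := Uorbit_anti hp (Nat.zero_le n) h
  rwa [zero_add, Uorbit_two hp] at this

lemma inv_le_Uorbit {p : ℕ} (hp : 3 ≤ p) {n : ℕ} (h : n + 3 ≤ p) :
    1 / heckeLambda p ≤ Uorbit (heckeLambda p) (n + 2) := by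
  have := Uorbit_anti hp (m := n) (n := p - 3) (by omega) (by omega)
  rwa [show p - 3 + 2 = p - 1 by omega, Uorbit_pred hp] at this

/-- `SL(2, ℝ)`. -/
abbrev SL2R := Matrix.SpecialLinearGroup (Fin 2) ℝ

lemma SL2R.mul_entry (A B : SL2R) (i j : Fin 2) :
    (A * B).1 i j = A.1 i 0 * B.1 0 j + A.1 i 1 * B.1 1 j := by
  simp [Matrix.mul_apply, Fin.sum_univ_two]

lemma SL2R.det_eq (A : SL2R) : A.1 0 0 * A.1 1 1 - A.1 0 1 * A.1 1 0 = 1 := by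
  rw [← Matrix.det_fin_two, A.2]

lemma SL2R.inv_entries (A : SL2R) : (A⁻¹).1 0 0 = A.1 1 1 ∧ (A⁻¹).1 0 1 = -A.1 0 1 ∧
    (A⁻¹).1 1 0 = -A.1 1 0 ∧ (A⁻¹).1 1 1 = A.1 0 0 := by
  simp [Matrix.SpecialLinearGroup.coe_inv, Matrix.adjugate_fin_two]

lemma SL2R.neg_entry (A : SL2R) (i j : Fin 2) : (-A).1 i j = -A.1 i j := by
  simp

lemma SL2R.ext_entries {A B : SL2R} (h00 : A.1 0 0 = B.1 0 0) (h01 : A.1 0 1 = B.1 0 1)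
    (h10 : A.1 1 0 = B.1 1 0) (h11 : A.1 1 1 = B.1 1 1) : A = B := by
  ext i j
  fin_cases i <;> fin_cases j <;> assumption

lemma Tgen_entries : Tgen.1 0 0 = 0 ∧ Tgen.1 0 1 = -1 ∧ Tgen.1 1 0 = 1 ∧ Tgen.1 1 1 = 0 := by
  simp [Tgen]

lemma Tgen_mul_self : Tgen * Tgen = -1 := by
  obtain ⟨h1, h2, h3, h4⟩ := Tgen_entries
  apply SL2R.ext_entries <;> rw [SL2R.mul_entry, SL2R.neg_entry] <;> simp [h1, h2, h3, h4]

/-- The nonnegative matrix `-U ^ (n + 1) * T`. -/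
def posMat (p : ℕ) (hp : 3 ≤ p) (n : ℕ) : SL2R :=
  ⟨!![sinRatio p (n + 1), sinRatio p (n + 2); sinRatio p n, sinRatio p (n + 1)], by
    rw [Matrix.det_fin_two_of, sinRatio_det hp]⟩

lemma posMat_entries (p : ℕ) (hp : 3 ≤ p) (n : ℕ) :
    (posMat p hp n).1 0 0 = sinRatio p (n + 1) ∧ (posMat p hp n).1 0 1 = sinRatio p (n + 2) ∧
    (posMat p hp n).1 1 0 = sinRatio p n ∧ (posMat p hp n).1 1 1 = sinRatio p (n + 1) := by
  simp [posMat]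

/-- `U = S * T` in `SL(2, ℝ)`. -/
def Ugen (l : ℝ) : SL2R := Sgen l * Tgen

lemma Ugen_entries (l : ℝ) : (Ugen l).1 0 0 = l ∧ (Ugen l).1 0 1 = -1 ∧
    (Ugen l).1 1 0 = 1 ∧ (Ugen l).1 1 1 = 0 := by
  obtain ⟨h1, h2, h3, h4⟩ := Tgen_entries
  simp only [Ugen, SL2R.mul_entry, h1, h2, h3, h4]
  simp [Sgen]

lemma Ugen_coe (l : ℝ) : (Ugen l).1 = Umat l := by
  obtain ⟨h1, h2, h3, h4⟩ := Ugen_entries l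
  ext i j
  fin_cases i <;> fin_cases j
  · exact h1
  · exact h2
  · exact h3
  · exact h4

lemma Ugen_pow_self {p : ℕ} (hp : 3 ≤ p) : Ugen (heckeLambda p) ^ p = -1 := by
  apply Subtype.ext
  have : (Ugen (heckeLambda p) ^ p).1 = (Ugen (heckeLambda p)).1 ^ p := by simp
  rw [this, Ugen_coe, Umat_pow_self hp]
  simp

lemma Sgen_eq_posMat {p : ℕ} (hp : 3 ≤ p) : Sgen (heckeLambda p) = posMat p hp 0 := by
  apply Subtype.ext
  simp [Sgen, posMat, sinRatio_one hp, sinRatio_two hp, sinRatio_zero]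

lemma Ugen_mul_posMat {p : ℕ} (hp : 3 ≤ p) (n : ℕ) :
    Ugen (heckeLambda p) * posMat p hp n = posMat p hp (n + 1) := by
  obtain ⟨h1, h2, h3, h4⟩ := Ugen_entries (heckeLambda p)
  obtain ⟨g1, g2, g3, g4⟩ := posMat_entries p hp n
  obtain ⟨k1, k2, k3, k4⟩ := posMat_entries p hp (n + 1)
  apply SL2R.ext_entries <;> rw [SL2R.mul_entry] <;>
    simp only [h1, h2, h3, h4, g1, g2, g3, g4, k1, k2, k3, k4]
  · rw [sinRatio_rec p n]; ring
  · rw [sinRatio_rec p (n + 1)]; ring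
  · ring
  · ring

lemma Ugen_mul_posMat_last {p : ℕ} (hp : 3 ≤ p) :
    Ugen (heckeLambda p) * posMat p hp (p - 2) = Tgen := by
  rw [Ugen_mul_posMat]
  obtain ⟨k1, k2, k3, k4⟩ := posMat_entries p hp (p - 2 + 1)
  obtain ⟨h1, h2, h3, h4⟩ := Tgen_entries
  have e1 : p - 2 + 1 + 1 = p := by omega
  have e2 : p - 2 + 1 + 2 = p + 1 := by omega
  have e3 : sinRatio p (p - 2 + 1) = 1 := by
    rw [show p - 2 + 1 = p - 1 by omega, sinRatio_pred hp]
  rw [e1, sinRatio_self hp] at k1 k4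
  rw [e2, sinRatio_succ_self hp] at k2
  rw [e3] at k3
  apply SL2R.ext_entries
  · rw [k1, h1]
  · rw [k2, h2]
  · rw [k3, h3]
  · rw [k4, h4]

/-- The monoid generated by the nonnegative matrices `posMat p hp n`, `n ≤ p - 2`. -/
inductive PosWord (p : ℕ) (hp : 3 ≤ p) : SL2R → Prop
  | one : PosWord p hp 1
  | cons (n : ℕ) (hn : n + 2 ≤ p) (W : SL2R) (hW : PosWord p hp W) :
      PosWord p hp (posMat p hp n * W)

namespace PosWord

variable {p : ℕ} {hp : 3 ≤ p}

lemma posMat {n : ℕ} (hn : n + 2 ≤ p) : PosWord p hp (posMat p hp n) := by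
  simpa using PosWord.one.cons (hp := hp) n hn

end PosWord

/-- A real number which is zero or at least one. -/
def ZeroOrGeOne (x : ℝ) : Prop := x = 0 ∨ 1 ≤ x

lemma ZeroOrGeOne.nonneg {x : ℝ} (h : ZeroOrGeOne x) : 0 ≤ x := by
  rcases h with h | h <;> linarith

lemma ZeroOrGeOne.add {x y : ℝ} (hx : ZeroOrGeOne x) (hy : ZeroOrGeOne y) :
    ZeroOrGeOne (x + y) := by
  have h1 := hx.nonneg
  have h2 := hy.nonneg
  rcases hx with rfl | hx
  · simpa using hy
  · exact Or.inr (by linarith)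

lemma ZeroOrGeOne.mul {x y : ℝ} (hx : ZeroOrGeOne x) (hy : ZeroOrGeOne y) :
    ZeroOrGeOne (x * y) := by
  rcases hx with rfl | hx
  · exact Or.inl (zero_mul y)
  rcases hy with rfl | hy
  · exact Or.inl (mul_zero x)
  · exact Or.inr (by nlinarith)

lemma sinRatio_zeroOrGeOne {p n : ℕ} (hp : 3 ≤ p) (h : n ≤ p) : ZeroOrGeOne (sinRatio p n) := by
  rcases Nat.eq_zero_or_pos n with rfl | h0
  · exact Or.inl (sinRatio_zero p)
  rcases h.eq_or_lt with rfl | h1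
  · exact Or.inl (sinRatio_self hp)
  · exact Or.inr (one_le_sinRatio hp h0 h1)

lemma posMat_zeroOrGeOne {p : ℕ} (hp : 3 ≤ p) {n : ℕ} (hn : n + 2 ≤ p) (i j : Fin 2) :
    ZeroOrGeOne ((posMat p hp n).1 i j) := by
  obtain ⟨h1, h2, h3, h4⟩ := posMat_entries p hp n
  fin_cases i <;> fin_cases j
  · exact h1 ▸ sinRatio_zeroOrGeOne hp (by omega)
  · exact h2 ▸ sinRatio_zeroOrGeOne hp (by omega)
  · exact h3 ▸ sinRatio_zeroOrGeOne hp (by omega)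
  · exact h4 ▸ sinRatio_zeroOrGeOne hp (by omega)

/-- The sum of the entries of a matrix. -/
def entrySum (A : SL2R) : ℝ := A.1 0 0 + A.1 0 1 + A.1 1 0 + A.1 1 1

namespace PosWord

variable {p : ℕ} {hp : 3 ≤ p} {W : SL2R}

lemma zeroOrGeOne (hW : PosWord p hp W) (i j : Fin 2) : ZeroOrGeOne (W.1 i j) := by
  induction hW generalizing i j with
  | one => fin_cases i <;> fin_cases j <;> simp [ZeroOrGeOne]
  | cons n hn W _ ih =>
    rw [SL2R.mul_entry]
    exact ((posMat_zeroOrGeOne hp hn _ _).mul (ih _ _)).add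
      ((posMat_zeroOrGeOne hp hn _ _).mul (ih _ _))

lemma nonneg (hW : PosWord p hp W) (i j : Fin 2) : 0 ≤ W.1 i j := (hW.zeroOrGeOne i j).nonneg

lemma one_le_diag (hW : PosWord p hp W) : 1 ≤ W.1 0 0 ∧ 1 ≤ W.1 1 1 := by
  have hdet := W.det_eq
  have h1 := hW.nonneg 0 1
  have h2 := hW.nonneg 1 0
  have h3 := mul_nonneg h1 h2
  constructor
  · rcases hW.zeroOrGeOne 0 0 with h | h
    · rw [h] at hdet; linarith
    · exact h
  · rcases hW.zeroOrGeOne 1 1 with h | h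
    · rw [h] at hdet; linarith
    · exact h

lemma entrySum_posMat_mul (hW : PosWord p hp W) {n : ℕ} (hn : n + 2 ≤ p) :
    entrySum W + 1 ≤ entrySum (_root_.posMat p hp n * W) := by
  obtain ⟨h1, h2, h3, h4⟩ := posMat_entries p hp n
  obtain ⟨hd1, hd2⟩ := hW.one_le_diag
  have ha := hW.nonneg 0 1
  have hb := hW.nonneg 1 0
  have s1 := one_le_sinRatio hp (n := n + 1) (by omega) (by omega)
  have s0 := sinRatio_nonneg hp (n := n) (by omega)
  have s2 := sinRatio_nonneg hp (n := n + 2) (by omega)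
  have key : 1 ≤ sinRatio p n ∨ 1 ≤ sinRatio p (n + 2) := by
    rcases Nat.eq_zero_or_pos n with rfl | h0
    · exact Or.inr (one_le_sinRatio hp (by omega) (by omega))
    · exact Or.inl (one_le_sinRatio hp h0 (by omega))
  simp only [entrySum, SL2R.mul_entry, h1, h2, h3, h4]
  have t1 : W.1 0 0 ≤ sinRatio p (n + 1) * W.1 0 0 := by nlinarith
  have t2 : W.1 0 1 ≤ sinRatio p (n + 1) * W.1 0 1 := by nlinarith
  have t3 : W.1 1 0 ≤ sinRatio p (n + 1) * W.1 1 0 := by nlinarith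
  have t4 : W.1 1 1 ≤ sinRatio p (n + 1) * W.1 1 1 := by nlinarith
  have u1 := mul_nonneg s0 ha
  have u2 := mul_nonneg s2 hb
  rcases key with key | key
  · nlinarith
  · nlinarith

lemma two_le_entrySum (hW : PosWord p hp W) : 2 ≤ entrySum W := by
  obtain ⟨hd1, hd2⟩ := hW.one_le_diag
  have ha := hW.nonneg 0 1
  have hb := hW.nonneg 1 0
  unfold entrySum
  linarith

end PosWord

lemma finite_posWord_entrySum_lt (p : ℕ) (hp : 3 ≤ p) (n : ℕ) :
    {W | PosWord p hp W ∧ entrySum W < 2 + n}.Finite := by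
  induction n with
  | zero =>
    convert Set.finite_empty
    ext W
    simp only [Set.mem_ofPred_eq, Set.mem_empty_iff_false, iff_false, not_and]
    intro hW
    have := hW.two_le_entrySum
    push_cast
    linarith
  | succ n ih =>
    refine ((Set.finite_singleton (1 : SL2R)).union
      ((Set.finite_Iic p).image2 (fun k W => posMat p hp k * W) ih)).subset ?_
    rintro W ⟨hW, hlt⟩
    cases hW with
    | one => exact Or.inl rfl
    | cons k hk W hW =>
      refine Or.inr ⟨k, by simp; omega, W, ⟨hW, ?_⟩, rfl⟩
      have := hW.entrySum_posMat_mul hk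
      push_cast at hlt
      linarith

/-- Up to sign, `g` is a positive word multiplied on either side by `1` or `T`. -/
def IsSignedWord (p : ℕ) (hp : 3 ≤ p) (g : SL2R) : Prop :=
  ∃ W, PosWord p hp W ∧ ∃ A, (A = 1 ∨ A = Tgen) ∧ ∃ B, (B = 1 ∨ B = Tgen) ∧
    (g = A * W * B ∨ g = -(A * W * B))

namespace IsSignedWord

variable {p : ℕ} {hp : 3 ≤ p} {g : SL2R}

lemma neg (h : IsSignedWord p hp g) : IsSignedWord p hp (-g) := by
  obtain ⟨W, hW, A, hA, B, hB, h⟩ := h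
  refine ⟨W, hW, A, hA, B, hB, ?_⟩
  rcases h with rfl | rfl
  · exact Or.inr rfl
  · exact Or.inl (neg_neg _)

lemma Tgen_mul (h : IsSignedWord p hp g) : IsSignedWord p hp (Tgen * g) := by
  obtain ⟨W, hW, A, hA, B, hB, h⟩ := h
  have key : IsSignedWord p hp (Tgen * (A * W * B)) := by
    rcases hA with rfl | rfl
    · exact ⟨W, hW, Tgen, Or.inr rfl, B, hB, Or.inl (by simp [mul_assoc])⟩
    · exact ⟨W, hW, 1, Or.inl rfl, B, hB, Or.inr (by simp [← mul_assoc, Tgen_mul_self])⟩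
  rcases h with rfl | rfl
  · exact key
  · rw [mul_neg]; exact key.neg

lemma Ugen_mul (h : IsSignedWord p hp g) : IsSignedWord p hp (Ugen (heckeLambda p) * g) := by
  obtain ⟨W, hW, A, hA, B, hB, h⟩ := h
  have hS : Ugen (heckeLambda p) = posMat p hp 0 * Tgen := by rw [Ugen, Sgen_eq_posMat hp]
  have key : IsSignedWord p hp (Ugen (heckeLambda p) * (A * W * B)) := by
    rcases hA with rfl | rfl
    · cases hW with
      | one =>
        rcases hB with rfl | rfl
        · exact ⟨_, PosWord.posMat (by omega : 0 + 2 ≤ p), 1, Or.inl rfl, Tgen, Or.inr rfl,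
            Or.inl (by rw [hS]; simp)⟩
        · exact ⟨_, PosWord.posMat (by omega : 0 + 2 ≤ p), 1, Or.inl rfl, 1, Or.inl rfl,
            Or.inr (by rw [hS]; simp [mul_assoc, Tgen_mul_self])⟩
      | cons n hn W hW =>
        rcases Nat.lt_or_ge (n + 2) p with hlt | hge
        · exact ⟨_, hW.cons (n + 1) (by omega), 1, Or.inl rfl, B, hB,
            Or.inl (by simp [← mul_assoc, Ugen_mul_posMat])⟩
        · obtain rfl : n = p - 2 := by omega
          exact ⟨W, hW, Tgen, Or.inr rfl, B, hB,
            Or.inl (by simp [← mul_assoc, Ugen_mul_posMat_last])⟩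
    · exact ⟨_, hW.cons 0 (by omega), 1, Or.inl rfl, B, hB, Or.inr (by
        rw [hS, show _root_.posMat p hp 0 * Tgen * (Tgen * W * B)
          = _root_.posMat p hp 0 * (Tgen * Tgen) * W * B by simp [mul_assoc], Tgen_mul_self]
        simp)⟩
  rcases h with rfl | rfl
  · exact key
  · rw [mul_neg]; exact key.neg

lemma Ugen_pow_mul (h : IsSignedWord p hp g) (n : ℕ) :
    IsSignedWord p hp (Ugen (heckeLambda p) ^ n * g) := by
  induction n with
  | zero => simpa using h
  | succ n ih => rw [pow_succ', mul_assoc]; exact ih.Ugen_mul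

lemma Tgen_inv : Tgen⁻¹ = -Tgen := by
  rw [inv_eq_iff_mul_eq_one, mul_neg, Tgen_mul_self, neg_neg]

lemma Ugen_inv (hp : 3 ≤ p) :
    (Ugen (heckeLambda p))⁻¹ = -Ugen (heckeLambda p) ^ (p - 1) := by
  rw [inv_eq_iff_mul_eq_one, mul_neg, ← pow_succ', Nat.sub_add_cancel (by omega),
    Ugen_pow_self hp, neg_neg]

lemma of_mem_heckeGroup (hg : g ∈ heckeGroup (heckeLambda p)) : IsSignedWord p hp g := by
  have hS : Sgen (heckeLambda p) = -(Ugen (heckeLambda p) * Tgen) := by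
    rw [Ugen, mul_assoc, Tgen_mul_self]; simp
  induction hg using Subgroup.closure_induction_left with
  | one => exact ⟨1, PosWord.one, 1, Or.inl rfl, 1, Or.inl rfl, Or.inl (by simp)⟩
  | mul_left x hx y _ ih =>
    rcases hx with rfl | rfl
    · rw [hS, neg_mul, mul_assoc]
      exact ih.Tgen_mul.Ugen_mul.neg
    · exact ih.Tgen_mul
  | inv_mul_cancel x hx y _ ih =>
    rcases hx with rfl | rfl
    · have : (Sgen (heckeLambda p))⁻¹ = -(Tgen * Ugen (heckeLambda p) ^ (p - 1)) := by
        rw [← mul_neg, ← Ugen_inv hp, Ugen, _root_.mul_inv_rev, ← mul_assoc, mul_inv_cancel,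
          one_mul]
      rw [this, neg_mul, mul_assoc]
      exact (ih.Ugen_pow_mul _).Tgen_mul.neg
    · rw [Tgen_inv, neg_mul]
      exact ih.Tgen_mul.neg

lemma entries (h : IsSignedWord p hp g) : ∃ W, PosWord p hp W ∧ ∃ e : ℝ, (e = 1 ∨ e = -1) ∧
    ((g.1 0 0 = e * W.1 0 0 ∧ g.1 0 1 = e * W.1 0 1 ∧
        g.1 1 0 = e * W.1 1 0 ∧ g.1 1 1 = e * W.1 1 1) ∨
      (g.1 0 0 = -(e * W.1 1 0) ∧ g.1 0 1 = -(e * W.1 1 1) ∧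
        g.1 1 0 = e * W.1 0 0 ∧ g.1 1 1 = e * W.1 0 1) ∨
      (g.1 0 0 = e * W.1 0 1 ∧ g.1 0 1 = -(e * W.1 0 0) ∧
        g.1 1 0 = e * W.1 1 1 ∧ g.1 1 1 = -(e * W.1 1 0)) ∨
      (g.1 0 0 = -(e * W.1 1 1) ∧ g.1 0 1 = e * W.1 1 0 ∧
        g.1 1 0 = e * W.1 0 1 ∧ g.1 1 1 = -(e * W.1 0 0))) := by
  obtain ⟨W, hW, A, hA, B, hB, h⟩ := h
  obtain ⟨e, he, h⟩ : ∃ e : ℝ, (e = 1 ∨ e = -1) ∧ ∀ i j, g.1 i j = e * (A * W * B).1 i j := by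
    rcases h with rfl | rfl
    · exact ⟨1, Or.inl rfl, fun i j => (one_mul _).symm⟩
    · exact ⟨-1, Or.inr rfl, fun i j => by rw [SL2R.neg_entry]; ring⟩
  obtain ⟨t1, t2, t3, t4⟩ := Tgen_entries
  refine ⟨W, hW, e, he, ?_⟩
  rw [h, h, h, h]
  rcases hA with rfl | rfl <;> rcases hB with rfl | rfl
  · left; simp
  · right; right; left
    simp only [one_mul, SL2R.mul_entry, t1, t2, t3, t4]
    refine ⟨?_, ?_, ?_, ?_⟩ <;> ring
  · right; left
    simp only [mul_one, SL2R.mul_entry, t1, t2, t3, t4]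
    refine ⟨?_, ?_, ?_, ?_⟩ <;> ring
  · right; right; right
    simp only [SL2R.mul_entry, t1, t2, t3, t4]
    refine ⟨?_, ?_, ?_, ?_⟩ <;> ring

end IsSignedWord

/-- Discreteness of the Hecke group. -/
lemma finite_heckeGroup_bounded {p : ℕ} (hp : 3 ≤ p) (B : ℝ) :
    {M : SL2R | M ∈ heckeGroup (heckeLambda p) ∧ ∀ i j, |M.1 i j| ≤ B}.Finite := by
  obtain ⟨n, hn⟩ := exists_nat_gt (4 * B)
  have hT : ({1, Tgen} : Set SL2R).Finite := Set.toFinite _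
  have hF := Set.Finite.image2 (fun A (BW : SL2R × SL2R) => A * BW.2 * BW.1) hT
    (hT.prod (finite_posWord_entrySum_lt p hp n))
  refine (hF.union (hF.image (fun M => -M))).subset ?_
  rintro M ⟨hM, hB⟩
  have hs := IsSignedWord.of_mem_heckeGroup (hp := hp) hM
  obtain ⟨W, hW, A, hA, C, hC, h⟩ := hs
  have hsum : entrySum W < 2 + n := by
    have hN : entrySum W = |M.1 0 0| + |M.1 0 1| + |M.1 1 0| + |M.1 1 1| := by
      obtain ⟨t1, t2, t3, t4⟩ := Tgen_entries
      have w1 := abs_of_nonneg (hW.nonneg 0 0)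
      have w2 := abs_of_nonneg (hW.nonneg 0 1)
      have w3 := abs_of_nonneg (hW.nonneg 1 0)
      have w4 := abs_of_nonneg (hW.nonneg 1 1)
      have habs : ∀ i j, |M.1 i j| = |(A * W * C).1 i j| := by
        rcases h with rfl | rfl
        · exact fun i j => rfl
        · exact fun i j => by rw [SL2R.neg_entry, abs_neg]
      rw [habs, habs, habs, habs, entrySum]
      rcases hA with rfl | rfl <;> rcases hC with rfl | rfl <;>
        simp only [one_mul, mul_one, SL2R.mul_entry, t1, t2, t3, t4, zero_mul, mul_zero, zero_add,
          add_zero, neg_mul, mul_neg, abs_neg, neg_neg, w1, w2, w3, w4] <;> ring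
    have b1 := hB 0 0
    have b2 := hB 0 1
    have b3 := hB 1 0
    have b4 := hB 1 1
    rw [hN]
    linarith
  have hmem : A * W * C ∈ Set.image2 (fun A (BW : SL2R × SL2R) => A * BW.2 * BW.1) {1, Tgen}
      (({1, Tgen} : Set SL2R) ×ˢ {W | PosWord p hp W ∧ entrySum W < 2 + n}) :=
    ⟨A, by simpa using hA, (C, W), ⟨by simpa using hC, hW, hsum⟩, rfl⟩
  rcases h with rfl | rfl
  · exact Or.inl hmem
  · exact Or.inr ⟨_, hmem, rfl⟩

lemma PosWord.trace_eq_two_of_mul_eq_zero {p : ℕ} {hp : 3 ≤ p} {W : SL2R} (hW : PosWord p hp W)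
    (h : W.1 0 1 * W.1 1 0 = 0) : W.1 0 0 + W.1 1 1 = 2 := by
  have hdet := W.det_eq
  obtain ⟨h1, h2⟩ := hW.one_le_diag
  rw [h] at hdet
  nlinarith

/-- A hyperbolic element of the Hecke group fixes neither `0` nor `∞`. -/
lemma hyperbolic_entries_ne_zero {p : ℕ} (hp : 3 ≤ p) {M : SL2R}
    (hM : M ∈ heckeGroup (heckeLambda p)) (ht : 2 < |M.1 0 0 + M.1 1 1|) :
    M.1 0 1 ≠ 0 ∧ M.1 1 0 ≠ 0 := by
  obtain ⟨W, hW, e, he, h⟩ := (IsSignedWord.of_mem_heckeGroup (hp := hp) hM).entries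
  obtain ⟨d1, d2⟩ := hW.one_le_diag
  have he0 : e ≠ 0 := by rcases he with rfl | rfl <;> norm_num
  have key : W.1 0 1 * W.1 1 0 = 0 → |W.1 0 0 + W.1 1 1| = 2 := fun h0 => by
    rw [hW.trace_eq_two_of_mul_eq_zero h0]; norm_num
  have hae : |e| = 1 := by rcases he with rfl | rfl <;> norm_num
  have n1 : W.1 0 0 ≠ 0 := by positivity
  have n2 : W.1 1 1 ≠ 0 := by positivity
  rcases h with ⟨h1, h2, h3, h4⟩ | ⟨h1, h2, h3, h4⟩ | ⟨h1, h2, h3, h4⟩ | ⟨h1, h2, h3, h4⟩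
  · rw [h1, h4, ← mul_add, abs_mul, hae, one_mul] at ht
    rw [h2, h3]
    exact ⟨mul_ne_zero he0 fun h0 => by rw [key (by rw [h0, zero_mul])] at ht; linarith,
      mul_ne_zero he0 fun h0 => by rw [key (by rw [h0, mul_zero])] at ht; linarith⟩
  · rw [h2, h3]
    exact ⟨neg_ne_zero.2 (mul_ne_zero he0 n2), mul_ne_zero he0 n1⟩
  · rw [h2, h3]
    exact ⟨neg_ne_zero.2 (mul_ne_zero he0 n1), mul_ne_zero he0 n2⟩
  · rw [h1, h4, ← neg_add, abs_neg, ← mul_add, abs_mul, hae, one_mul, add_comm] at ht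
    rw [h2, h3]
    exact ⟨mul_ne_zero he0 fun h0 => by rw [key (by rw [h0, mul_zero])] at ht; linarith,
      mul_ne_zero he0 fun h0 => by rw [key (by rw [h0, zero_mul])] at ht; linarith⟩

/-- An element of the Hecke group whose off-diagonal product is positive has entries bounded in
terms of its trace. -/
lemma abs_entry_le_of_offDiag_pos {p : ℕ} (hp : 3 ≤ p) {M : SL2R}
    (hM : M ∈ heckeGroup (heckeLambda p)) (hpos : 0 < M.1 0 1 * M.1 1 0) (i j : Fin 2) :
    |M.1 i j| ≤ |M.1 0 0 + M.1 1 1| ^ 2 := by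
  obtain ⟨W, hW, e, he, h⟩ := (IsSignedWord.of_mem_heckeGroup (hp := hp) hM).entries
  obtain ⟨d1, d2⟩ := hW.one_le_diag
  have hee : e * e = 1 := by rcases he with rfl | rfl <;> norm_num
  have hae : |e| = 1 := by rcases he with rfl | rfl <;> norm_num
  have hdet := W.det_eq
  have z2 := hW.zeroOrGeOne 0 1
  have z3 := hW.zeroOrGeOne 1 0
  have hWpos : M.1 0 1 * M.1 1 0 = W.1 0 1 * W.1 1 0 →
      W.1 0 0 ≤ (W.1 0 0 + W.1 1 1) ^ 2 ∧ W.1 0 1 ≤ (W.1 0 0 + W.1 1 1) ^ 2 ∧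
      W.1 1 0 ≤ (W.1 0 0 + W.1 1 1) ^ 2 ∧ W.1 1 1 ≤ (W.1 0 0 + W.1 1 1) ^ 2 := by
    intro hEq
    rw [hEq] at hpos
    rcases z2 with z2 | z2
    · rw [z2, zero_mul] at hpos; exact absurd hpos (lt_irrefl _)
    rcases z3 with z3 | z3
    · rw [z3, mul_zero] at hpos; exact absurd hpos (lt_irrefl _)
    refine ⟨by nlinarith, ?_, ?_, by nlinarith⟩
    · have : W.1 0 1 ≤ W.1 0 1 * W.1 1 0 := by nlinarith
      nlinarith
    · have : W.1 1 0 ≤ W.1 0 1 * W.1 1 0 := by nlinarith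
      nlinarith
  have w1 := abs_of_nonneg (hW.nonneg 0 0)
  have w2 := abs_of_nonneg (hW.nonneg 0 1)
  have w3 := abs_of_nonneg (hW.nonneg 1 0)
  have w4 := abs_of_nonneg (hW.nonneg 1 1)
  rw [sq_abs]
  rcases h with ⟨h1, h2, h3, h4⟩ | ⟨h1, h2, h3, h4⟩ | ⟨h1, h2, h3, h4⟩ | ⟨h1, h2, h3, h4⟩
  · obtain ⟨k1, k2, k3, k4⟩ := hWpos (by rw [h2, h3]; linear_combination W.1 0 1 * W.1 1 0 * hee)
    have ht : (M.1 0 0 + M.1 1 1) ^ 2 = (W.1 0 0 + W.1 1 1) ^ 2 := by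
      rw [h1, h4]; linear_combination (W.1 0 0 + W.1 1 1) ^ 2 * hee
    rw [ht]
    fin_cases i <;> fin_cases j
    · change |M.1 0 0| ≤ _; rwa [h1, abs_mul, hae, one_mul, w1]
    · change |M.1 0 1| ≤ _; rwa [h2, abs_mul, hae, one_mul, w2]
    · change |M.1 1 0| ≤ _; rwa [h3, abs_mul, hae, one_mul, w3]
    · change |M.1 1 1| ≤ _; rwa [h4, abs_mul, hae, one_mul, w4]
  · rw [h2, h3, show -(e * W.1 1 1) * (e * W.1 0 0) = -(e * e * (W.1 1 1 * W.1 0 0)) by ring,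
      hee] at hpos
    nlinarith
  · rw [h2, h3, show -(e * W.1 0 0) * (e * W.1 1 1) = -(e * e * (W.1 1 1 * W.1 0 0)) by ring,
      hee] at hpos
    nlinarith
  · obtain ⟨k1, k2, k3, k4⟩ := hWpos (by rw [h2, h3]; linear_combination W.1 0 1 * W.1 1 0 * hee)
    have ht : (M.1 0 0 + M.1 1 1) ^ 2 = (W.1 0 0 + W.1 1 1) ^ 2 := by
      rw [h1, h4]; linear_combination (W.1 0 0 + W.1 1 1) ^ 2 * hee
    rw [ht]
    fin_cases i <;> fin_cases j
    · change |M.1 0 0| ≤ _; rwa [h1, abs_neg, abs_mul, hae, one_mul, w4]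
    · change |M.1 0 1| ≤ _; rwa [h2, abs_mul, hae, one_mul, w3]
    · change |M.1 1 0| ≤ _; rwa [h3, abs_mul, hae, one_mul, w2]
    · change |M.1 1 1| ≤ _; rwa [h4, abs_neg, abs_mul, hae, one_mul, w1]

lemma fixesQuad_relations {M : SL2R} {x y : ℝ} (hx : fixesQuad M x) (hy : fixesQuad M y)
    (hxy : y ≠ x) :
    M.1 0 0 = M.1 1 1 + M.1 1 0 * (x + y) ∧ M.1 0 1 = -(M.1 1 0 * (x * y)) := by
  unfold fixesQuad at hx hy
  have h : M.1 0 0 = M.1 1 1 + M.1 1 0 * (x + y) := by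
    have : (y - x) * (M.1 1 1 + M.1 1 0 * (x + y) - M.1 0 0) = 0 := by
      linear_combination hy - hx
    rcases mul_eq_zero.1 this with h | h
    · exact absurd (sub_eq_zero.1 h) hxy
    · linarith
  refine ⟨h, ?_⟩
  rw [h] at hx
  linear_combination -hx

lemma eq_or_eq_of_fixesQuad {M : SL2R} {x y z : ℝ} (hx : fixesQuad M x) (hy : fixesQuad M y)
    (hxy : y ≠ x) (hc : M.1 1 0 ≠ 0) (hz : fixesQuad M z) : z = x ∨ z = y := by
  obtain ⟨h1, h2⟩ := fixesQuad_relations hx hy hxy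
  unfold fixesQuad at hz
  rw [h1, h2] at hz
  have : M.1 1 0 * ((z - x) * (z - y)) = 0 := by linear_combination hz
  rcases mul_eq_zero.1 ((mul_eq_zero.1 this).resolve_left hc) with h | h
  · exact Or.inl (sub_eq_zero.1 h)
  · exact Or.inr (sub_eq_zero.1 h)

lemma fixesQuad_of_contracting {p : ℕ} (hp : 3 ≤ p) {M P : SL2R} {x y : ℝ}
    (hM : M ∈ heckeGroup (heckeLambda p)) (hP : P ∈ heckeGroup (heckeLambda p))
    (ht : 2 < |M.1 0 0 + M.1 1 1|) (hx : fixesQuad M x) (hy : fixesQuad M y) (hxy : y ≠ x)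
    (hPx : fixesQuad P x) (hcon : |M.1 1 0 * y + M.1 1 1| ≤ |M.1 1 0 * x + M.1 1 1|) :
    fixesQuad P y := by
  obtain ⟨ha, hb⟩ := fixesQuad_relations hx hy hxy
  obtain ⟨i1, i2, i3, i4⟩ := M.inv_entries
  have hdet := M.det_eq
  set c := M.1 1 0
  set d := M.1 1 1
  rw [ha, hb] at hdet
  rw [ha] at ht i4
  rw [hb] at i2
  have hmm : (c * x + d) * (c * y + d) = 1 := by linear_combination hdet
  have hq1 : (c * y + d) ^ 2 ≤ 1 := by
    rw [← sq_abs]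
    have h1 : |c * x + d| * |c * y + d| = 1 := by rw [← abs_mul, hmm, abs_one]
    nlinarith [abs_nonneg (c * y + d)]
  have hq2 : (c * y + d) ^ 2 ≠ 1 := by
    intro h
    have h' : (c * y + d - 1) * (c * y + d + 1) = 0 := by linear_combination h
    have key : ∀ e : ℝ, c * y + d = e → c * x + d = e → |e| = 1 → False := by
      intro e h1 h2 he
      rw [show d + c * (x + y) + d = 2 * e by linear_combination h1 + h2, abs_mul, he] at ht
      norm_num at ht
    rcases mul_eq_zero.1 h' with h | h
    · have h1 : c * y + d = 1 := by linarith
      rw [h1, mul_one] at hmm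
      exact key 1 h1 hmm (by simp)
    · have h1 : c * y + d = -1 := by linarith
      rw [h1] at hmm
      exact key (-1) h1 (by linarith) (by simp)
  have hq0 : 0 < (c * y + d) ^ 2 := by
    have : c * y + d ≠ 0 := right_ne_zero_of_mul (hmm ▸ one_ne_zero)
    positivity
  have hsub : (x - y) ^ 2 ≠ 0 := pow_ne_zero 2 (sub_ne_zero.2 hxy.symm)
  set A := P.1 0 0 with hA
  set B := P.1 0 1 with hB
  set C := P.1 1 0 with hC
  set D := P.1 1 1 with hD
  set q := (c * y + d) ^ 2 with hq
  obtain ⟨e, he⟩ : ∃ e, C * y ^ 2 + (D - A) * y - B = e * (x - y) ^ 2 :=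
    ⟨_, (div_mul_cancel₀ _ hsub).symm⟩
  have hPx' : C * x ^ 2 + (D - A) * x - B = 0 := hPx
  have hA' : A = D + C * (x + y) + e * (x - y) := by
    have : (y - x) * (D + C * (x + y) + e * (x - y) - A) = 0 := by
      linear_combination he - hPx'
    rcases mul_eq_zero.1 this with h | h
    · exact absurd (sub_eq_zero.1 h) hxy
    · linarith
  have hB' : B = -(C * (x * y)) - e * (x - y) * x := by
    rw [hA'] at hPx'; linear_combination -hPx'
  have hseq : ∀ n : ℕ, ((M ^ n)⁻¹ * P * M ^ n).1 0 0 = A + e * (q ^ n - 1) * x ∧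
      ((M ^ n)⁻¹ * P * M ^ n).1 0 1 = B - e * (q ^ n - 1) * x ^ 2 ∧
      ((M ^ n)⁻¹ * P * M ^ n).1 1 0 = C + e * (q ^ n - 1) ∧
      ((M ^ n)⁻¹ * P * M ^ n).1 1 1 = D - e * (q ^ n - 1) * x := by
    intro n
    induction n with
    | zero => simp [hA, hB, hC, hD]
    | succ n ih =>
      obtain ⟨j1, j2, j3, j4⟩ := ih
      have hstep : (M ^ (n + 1))⁻¹ * P * M ^ (n + 1) = M⁻¹ * ((M ^ n)⁻¹ * P * M ^ n) * M := by
        rw [pow_succ, _root_.mul_inv_rev]; simp only [mul_assoc]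
      rw [hstep]
      simp only [SL2R.mul_entry _ M, SL2R.mul_entry M⁻¹, i1, i2, i3, i4, j1, j2, j3, j4, ha, hb]
      rw [pow_succ q n]
      generalize q ^ n = Q
      rw [hA', hB', hq]
      refine ⟨?_, ?_, ?_, ?_⟩
      · linear_combination (D + C * (x + y) + e * (x - y) - e * x) * hdet
      · linear_combination (-(C * (x * y)) - e * (x - y) * x + e * x ^ 2) * hdet
      · linear_combination (C - e) * hdet
      · linear_combination (D + e * x) * hdet
  by_contra hne
  have he0 : e ≠ 0 := by
    rintro rfl
    exact hne (by unfold fixesQuad; rw [he, zero_mul])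
  have hinj : Function.Injective fun n : ℕ => (M ^ n)⁻¹ * P * M ^ n := by
    intro m n hmn
    have h1 := (hseq m).2.2.1
    have h2 := (hseq n).2.2.1
    simp only at hmn
    rw [hmn, h2] at h1
    have : q ^ n = q ^ m := by
      have := mul_left_cancel₀ he0 (add_left_cancel h1)
      linarith
    exact (pow_right_injective₀ hq0 hq2 this).symm
  refine Set.infinite_of_injective_forall_mem hinj (fun n => ?_)
    (finite_heckeGroup_bounded hp (|A| + |B| + |C| + |D| + |e| * (1 + |x| + |x| ^ 2)))
  refine ⟨mul_mem (mul_mem (inv_mem (pow_mem hM n)) hP) (pow_mem hM n), ?_⟩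
  obtain ⟨j1, j2, j3, j4⟩ := hseq n
  have hf : |e * (q ^ n - 1)| ≤ |e| := by
    rw [abs_mul]
    have h1 := pow_le_one₀ hq0.le hq1 (n := n)
    have h2 := pow_pos hq0 n
    have : |q ^ n - 1| ≤ 1 := abs_le.2 ⟨by linarith, by linarith⟩
    nlinarith [abs_nonneg e]
  generalize e * (q ^ n - 1) = f at *
  have a1 := abs_nonneg A
  have a2 := abs_nonneg B
  have a3 := abs_nonneg C
  have a4 := abs_nonneg D
  have a5 := abs_nonneg x
  have a6 := abs_nonneg e
  have f1 : |f * x| ≤ |e| * |x| := by rw [abs_mul]; gcongr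
  have f2 : |f * x ^ 2| ≤ |e| * |x| ^ 2 := by rw [abs_mul, abs_pow]; gcongr
  have f3 : 0 ≤ |e| * |x| := by positivity
  have f4 : 0 ≤ |e| * |x| ^ 2 := by positivity
  intro i j
  fin_cases i <;> fin_cases j
  · change |((M ^ n)⁻¹ * P * M ^ n).1 0 0| ≤ _
    rw [j1]; linarith [abs_add_le A (f * x)]
  · change |((M ^ n)⁻¹ * P * M ^ n).1 0 1| ≤ _
    rw [j2]; linarith [abs_sub B (f * x ^ 2)]
  · change |((M ^ n)⁻¹ * P * M ^ n).1 1 0| ≤ _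
    rw [j3]; linarith [abs_add_le C f]
  · change |((M ^ n)⁻¹ * P * M ^ n).1 1 1| ≤ _
    rw [j4]; linarith [abs_sub D (f * x)]

lemma fixesQuad_inv {M : SL2R} {x : ℝ} (hx : fixesQuad M x) : fixesQuad M⁻¹ x := by
  obtain ⟨i1, i2, i3, i4⟩ := M.inv_entries
  unfold fixesQuad at *
  rw [i1, i2, i3, i4]
  linear_combination -hx

/-- An element of the Hecke group sharing a fixed point with a hyperbolic element also fixes the
other fixed point. -/
lemma fixesQuad_conjugate {p : ℕ} (hp : 3 ≤ p) {M P : SL2R} {x y : ℝ}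
    (hM : M ∈ heckeGroup (heckeLambda p)) (hP : P ∈ heckeGroup (heckeLambda p))
    (ht : 2 < |M.1 0 0 + M.1 1 1|) (hx : fixesQuad M x) (hy : fixesQuad M y) (hxy : y ≠ x)
    (hPx : fixesQuad P x) : fixesQuad P y := by
  rcases le_total |M.1 1 0 * y + M.1 1 1| |M.1 1 0 * x + M.1 1 1| with h | h
  · exact fixesQuad_of_contracting hp hM hP ht hx hy hxy hPx h
  · obtain ⟨i1, i2, i3, i4⟩ := M.inv_entries
    obtain ⟨ha, -⟩ := fixesQuad_relations hx hy hxy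
    refine fixesQuad_of_contracting hp (inv_mem hM) hP ?_ (fixesQuad_inv hx) (fixesQuad_inv hy)
      hxy hPx ?_
    · rwa [i1, i4, add_comm]
    · rw [i3, i4, ha, show -M.1 1 0 * y + (M.1 1 1 + M.1 1 0 * (x + y)) = M.1 1 0 * x + M.1 1 1 by
        ring, show -M.1 1 0 * x + (M.1 1 1 + M.1 1 0 * (x + y)) = M.1 1 0 * y + M.1 1 1 by ring]
      exact h

lemma fixesQuad_conj {A M : SL2R} {x : ℝ} (hx : fixesQuad M x)
    (hAx : A.1 1 0 * x + A.1 1 1 ≠ 0) : fixesQuad (A * M * A⁻¹) (mobius A.1 x) := by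
  obtain ⟨i1, i2, i3, i4⟩ := A.inv_entries
  unfold fixesQuad mobius at *
  simp only [SL2R.mul_entry _ A⁻¹, SL2R.mul_entry A M, i1, i2, i3, i4]
  field_simp
  linear_combination (A.1 0 0 * A.1 1 1 - A.1 0 1 * A.1 1 0) ^ 2 * hx

lemma trace_conj (A M : SL2R) :
    (A * M * A⁻¹).1 0 0 + (A * M * A⁻¹).1 1 1 = M.1 0 0 + M.1 1 1 := by
  obtain ⟨i1, i2, i3, i4⟩ := A.inv_entries
  simp only [SL2R.mul_entry _ A⁻¹, SL2R.mul_entry A M, i1, i2, i3, i4]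
  linear_combination (M.1 0 0 + M.1 1 1) * A.det_eq

lemma IsHypFixedPt.mobius {l x : ℝ} (h : IsHypFixedPt l x) {A : SL2R} (hA : A ∈ heckeGroup l)
    (hAx : A.1 1 0 * x + A.1 1 1 ≠ 0) : IsHypFixedPt l (mobius A.1 x) := by
  obtain ⟨M, hM, ht, hx⟩ := h
  exact ⟨A * M * A⁻¹, mul_mem (mul_mem hA hM) (inv_mem hA), by rwa [trace_conj],
    fixesQuad_conj hx hAx⟩

lemma IsHypFixedPt.ne_zero {p : ℕ} (hp : 3 ≤ p) {x : ℝ} (h : IsHypFixedPt (heckeLambda p) x) :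
    x ≠ 0 := by
  obtain ⟨M, hM, ht, hx⟩ := h
  rintro rfl
  unfold fixesQuad at hx
  refine (hyperbolic_entries_ne_zero hp hM ht).1 ?_
  linear_combination -hx

/-- `x` and `y` are the two fixed points of an element of the Hecke group of absolute trace `t`. -/
def IsFixedPair (l t x y : ℝ) : Prop :=
  ∃ M ∈ heckeGroup l, |M.1 0 0 + M.1 1 1| = t ∧ fixesQuad M x ∧ fixesQuad M y ∧ y ≠ x

lemma IsHypPair.exists_isFixedPair {l x y : ℝ} (h : IsHypPair l x y) :
    ∃ t, 2 < t ∧ IsFixedPair l t x y := by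
  obtain ⟨M, hM, ht, h⟩ := h
  exact ⟨_, ht, M, hM, rfl, h⟩

namespace IsFixedPair

variable {p : ℕ} {t x y : ℝ}

lemma unique (hp : 3 ≤ p) {t' y' : ℝ} (ht : 2 < t) (ht' : 2 < t')
    (h : IsFixedPair (heckeLambda p) t x y) (h' : IsFixedPair (heckeLambda p) t' x y') :
    y = y' := by
  obtain ⟨M, hM, rfl, hx, hy, hxy⟩ := h
  obtain ⟨M', hM', rfl, hx', hy', hxy'⟩ := h'
  have := fixesQuad_conjugate hp hM hM' ht hx hy hxy hx'
  exact (eq_or_eq_of_fixesQuad hx' hy' hxy' (hyperbolic_entries_ne_zero hp hM' ht').2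
    this).resolve_left hxy

lemma isHypFixedPt {l : ℝ} (ht : 2 < t) (h : IsFixedPair l t x y) : IsHypFixedPt l x := by
  obtain ⟨M, hM, rfl, hx, -⟩ := h
  exact ⟨M, hM, ht, hx⟩

lemma symm {l : ℝ} (h : IsFixedPair l t x y) : IsFixedPair l t y x := by
  obtain ⟨M, hM, ht, hx, hy, hxy⟩ := h
  exact ⟨M, hM, ht, hy, hx, hxy.symm⟩

lemma mobius {l : ℝ} (h : IsFixedPair l t x y) {A : SL2R} (hA : A ∈ heckeGroup l)
    (hAx : A.1 1 0 * x + A.1 1 1 ≠ 0) (hAy : A.1 1 0 * y + A.1 1 1 ≠ 0) :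
    IsFixedPair l t (mobius A.1 x) (mobius A.1 y) := by
  obtain ⟨M, hM, rfl, hx, hy, hxy⟩ := h
  refine ⟨A * M * A⁻¹, mul_mem (mul_mem hA hM) (inv_mem hA), by rw [trace_conj],
    fixesQuad_conj hx hAx, fixesQuad_conj hy hAy, ?_⟩
  intro h
  unfold _root_.mobius at h
  rw [div_eq_div_iff hAy hAx] at h
  apply hxy
  linear_combination h - (y - x) * A.det_eq

lemma finite (hp : 3 ≤ p) (ht : 2 < t) :
    {z : ℝ × ℝ | IsFixedPair (heckeLambda p) t z.1 z.2 ∧ z.2 < 0 ∧ 0 < z.1}.Finite := by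
  have hF := finite_heckeGroup_bounded hp (t ^ 2)
  refine (hF.biUnion (t := fun M => {z : ℝ × ℝ | (fixesQuad M z.1 ∧ fixesQuad M z.2 ∧
    z.2 < 0 ∧ 0 < z.1) ∧ M.1 1 0 ≠ 0}) fun M _ => ?_).subset ?_
  · apply Set.Subsingleton.finite
    rintro ⟨x, y⟩ ⟨⟨hx, hy, hy0, hx0⟩, hc⟩ ⟨x', y'⟩ ⟨⟨hx', hy', hy0', hx0'⟩, -⟩
    simp only at *
    have hne : y ≠ x := by linarith
    have e1 := eq_or_eq_of_fixesQuad hx hy hne hc hx'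
    have e2 := eq_or_eq_of_fixesQuad hx hy hne hc hy'
    rcases e1 with rfl | rfl
    · rcases e2 with rfl | rfl
      · linarith
      · rfl
    · linarith
  · rintro ⟨x, y⟩ ⟨⟨M, hM, rfl, hx, hy, hxy⟩, hy0, hx0⟩
    simp only at *
    obtain ⟨h1, h2⟩ := fixesQuad_relations hx hy hxy
    have hc := (hyperbolic_entries_ne_zero hp hM ht).2
    rw [Set.mem_iUnion₂]
    refine ⟨M, ⟨hM, fun i j => abs_entry_le_of_offDiag_pos hp hM ?_ i j⟩,
      ⟨hx, hy, hy0, hx0⟩, hc⟩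
    rw [h2, show -(M.1 1 0 * (x * y)) * M.1 1 0 = M.1 1 0 ^ 2 * (x * -y) by ring]
    have : 0 < -y := by linarith
    positivity

end IsFixedPair

lemma posMat_mem_heckeGroup {p : ℕ} (hp : 3 ≤ p) (n : ℕ) :
    posMat p hp n ∈ heckeGroup (heckeLambda p) := by
  have hS : Sgen (heckeLambda p) ∈ heckeGroup (heckeLambda p) :=
    Subgroup.subset_closure (by simp)
  induction n with
  | zero => rwa [← Sgen_eq_posMat hp]
  | succ n ih =>
    rw [← Ugen_mul_posMat]
    exact mul_mem (mul_mem hS (Subgroup.subset_closure (by simp))) ih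

lemma IsHypFixedPt.ne_Uorbit {p : ℕ} (hp : 3 ≤ p) {x : ℝ} (h : IsHypFixedPt (heckeLambda p) x)
    {n : ℕ} (hn : n + 3 ≤ p) : x ≠ Uorbit (heckeLambda p) (n + 2) := by
  intro hx
  obtain ⟨i1, i2, i3, i4⟩ := (posMat p hp n).inv_entries
  obtain ⟨k1, k2, k3, k4⟩ := posMat_entries p hp n
  have h1 := one_le_sinRatio hp (n := n + 1) (by omega) (by omega)
  have hs : sinRatio p (n + 1) ≠ 0 := by positivity
  rw [Uorbit_succ hp, eq_div_iff hs] at hx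
  have hd : sinRatio p (n + 1) * (-sinRatio p n * x + sinRatio p (n + 1)) = 1 := by
    linear_combination sinRatio_det hp n - sinRatio p n * hx
  refine (h.mobius (inv_mem (posMat_mem_heckeGroup hp n)) ?_).ne_zero hp ?_
  · rw [i3, i4, k1, k3]
    exact right_ne_zero_of_mul (hd ▸ one_ne_zero)
  · unfold _root_.mobius
    rw [i1, i2, i3, i4, k1, k2, k3, k4, div_eq_zero_iff]
    left
    linear_combination hx

/-- The next complete quotient. -/
def cqNext (l x : ℝ) : ℝ := 1 / (((⌊x / l⌋ : ℝ) + 1) * l - x)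

lemma cq_succ (l x : ℝ) (j : ℕ) : cq l x (j + 1) = cqNext l (cq l x j) := rfl

lemma cq_add (l x : ℝ) (i j : ℕ) : cq l x (i + j) = cq l (cq l x i) j := by
  induction j with
  | zero => rfl
  | succ j ih => rw [← add_assoc, cq_succ, cq_succ, ih]

lemma cq_mul_of_eq {l x : ℝ} {m : ℕ} (h : cq l x m = x) (i : ℕ) : cq l x (m * i) = x := by
  induction i with
  | zero => rfl
  | succ i ih => rw [mul_add_one, cq_add, ih, h]

lemma floor_add_one_mul_sub_pos {l : ℝ} (hl : 0 < l) (x : ℝ) :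
    0 < ((⌊x / l⌋ : ℝ) + 1) * l - x := by
  have := Int.lt_floor_add_one (x / l)
  rw [div_lt_iff₀ hl] at this
  linarith

lemma inv_le_cqNext {l : ℝ} (hl : 0 < l) (x : ℝ) : 1 / l ≤ cqNext l x := by
  have h := Int.floor_le (x / l)
  rw [le_div_iff₀ hl] at h
  exact one_div_le_one_div_of_le (floor_add_one_mul_sub_pos hl x) (by linarith)

/-- `x` lies in the interval `[U ^ (n + 2) (0), U ^ (n + 1) (0))`. -/
structure InLevel (p n : ℕ) (x : ℝ) : Prop where
  le : n + 3 ≤ p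
  lower : Uorbit (heckeLambda p) (n + 2) ≤ x
  upper : n = 0 ∨ x < Uorbit (heckeLambda p) (n + 1)

lemma exists_inLevel {p : ℕ} (hp : 3 ≤ p) {x : ℝ} (hx : 1 / heckeLambda p ≤ x) :
    ∃ n, InLevel p n x := by
  classical
  have hex : ∃ n, Uorbit (heckeLambda p) (n + 2) ≤ x :=
    ⟨p - 3, by rwa [show p - 3 + 2 = p - 1 by omega, Uorbit_pred hp]⟩
  refine ⟨Nat.find hex, ?_, Nat.find_spec hex, ?_⟩
  · have : Nat.find hex ≤ p - 3 :=
      Nat.find_min' hex (by rwa [show p - 3 + 2 = p - 1 by omega, Uorbit_pred hp])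
    omega
  · rcases Nat.eq_zero_or_pos (Nat.find hex) with h | h
    · exact Or.inl h
    · right
      have := Nat.find_min hex (Nat.sub_one_lt h.ne')
      rw [show Nat.find hex - 1 + 2 = Nat.find hex + 1 by omega] at this
      exact not_le.1 this

namespace InLevel

variable {p n : ℕ} {x : ℝ}

lemma floor_eq_zero (hp : 3 ≤ p) (h : InLevel p (n + 1) x) : ⌊x / heckeLambda p⌋ = 0 := by
  have hl := one_le_heckeLambda hp
  have h1 := Uorbit_pos hp h.le
  have h2 := h.lower
  have h3 := h.upper.resolve_left (by omega)
  have h4 := Uorbit_le_heckeLambda hp (n := n) (by have := h.le; omega)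
  rw [Int.floor_eq_zero_iff, Set.mem_Ico, div_lt_one (by linarith)]
  exact ⟨div_nonneg (by linarith) (by linarith), h3.trans_le h4⟩

lemma one_le_floor (hp : 3 ≤ p) (h : InLevel p 0 x) : 1 ≤ ⌊x / heckeLambda p⌋ := by
  have hl := one_le_heckeLambda hp
  have := h.lower
  rw [zero_add, Uorbit_two hp] at this
  rw [Int.le_floor, Int.cast_one, one_le_div (by linarith)]
  exact this

lemma cqNext (hp : 3 ≤ p) (h : InLevel p (n + 1) x) : InLevel p n (cqNext (heckeLambda p) x) := by
  have hle := h.le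
  have h1 := h.lower
  have h2 := h.upper.resolve_left (by omega)
  have h4 := Uorbit_le_heckeLambda hp (n := n) (by omega)
  have hu := Uorbit_pos hp (n := n) (by omega)
  rw [_root_.cqNext, h.floor_eq_zero hp, Int.cast_zero, zero_add, one_mul]
  have hr := Uorbit_rec hp (n := n) (by omega)
  have hpos : 0 < heckeLambda p - x := by linarith
  refine ⟨by omega, ?_, ?_⟩
  · rw [le_one_div hu hpos]
    linarith
  · rcases n with _ | n
    · exact Or.inl rfl
    · right
      have hu' := Uorbit_pos hp (n := n) (by omega)
      have hr' := Uorbit_rec hp (n := n) (by omega)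
      rw [one_div_lt hpos hu']
      linarith

lemma cq (hp : 3 ≤ p) (h : InLevel p n x) {j : ℕ} (hj : j ≤ n) :
    InLevel p (n - j) (cq (heckeLambda p) x j) := by
  induction j with
  | zero => exact h
  | succ j ih =>
    have := ih (by omega)
    rw [show n - j = n - (j + 1) + 1 by omega] at this
    exact this.cqNext hp

lemma pq_eq_one (hp : 3 ≤ p) (h : InLevel p n x) {j : ℕ} (hj : j < n) :
    pq (heckeLambda p) x j = 1 := by
  have := h.cq hp hj.le
  rw [show n - j = n - j - 1 + 1 by omega] at this
  rw [pq, this.floor_eq_zero hp, zero_add]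

lemma two_le_pq (hp : 3 ≤ p) (h : InLevel p n x) : 2 ≤ pq (heckeLambda p) x n := by
  have := h.cq hp le_rfl
  rw [Nat.sub_self] at this
  have := this.one_le_floor hp
  unfold pq
  omega

lemma eq_of_pq (hp : 3 ≤ p) (h : InLevel p n x) {k : ℕ}
    (h1 : ∀ j < k, pq (heckeLambda p) x j = 1) (h2 : 2 ≤ pq (heckeLambda p) x k) : n = k := by
  rcases lt_trichotomy n k with hnk | hnk | hnk
  · have := h.two_le_pq hp
    have := h1 n hnk
    omega
  · exact hnk
  · have := h.pq_eq_one hp hnk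
    omega

lemma unique (hp : 3 ≤ p) (h : InLevel p n x) {k : ℕ} (h' : InLevel p k x) : n = k :=
  h.eq_of_pq hp (fun _ hj => h'.pq_eq_one hp hj) (h'.two_le_pq hp)

end InLevel

/-- The matrix `(S ^ r * T)⁻¹`. -/
def stepMat (l : ℝ) (r : ℤ) : SL2R := ⟨!![0, 1; -1, r * l], by simp [Matrix.det_fin_two_of]⟩

lemma stepMat_entries (l : ℝ) (r : ℤ) : (stepMat l r).1 0 0 = 0 ∧ (stepMat l r).1 0 1 = 1 ∧
    (stepMat l r).1 1 0 = -1 ∧ (stepMat l r).1 1 1 = r * l := by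
  simp [stepMat]

lemma stepMat_mem_heckeGroup (l : ℝ) (r : ℤ) : stepMat l r ∈ heckeGroup l := by
  have hS : Sgen l ∈ heckeGroup l := Subgroup.subset_closure (by simp)
  have hT : Tgen ∈ heckeGroup l := Subgroup.subset_closure (by simp)
  obtain ⟨t1, t2, t3, t4⟩ := Tgen_entries
  have h0 : stepMat l 0 = Tgen⁻¹ := by
    obtain ⟨j1, j2, j3, j4⟩ := SL2R.inv_entries Tgen
    obtain ⟨k1, k2, k3, k4⟩ := stepMat_entries l 0
    apply SL2R.ext_entries <;> simp only [j1, j2, j3, j4, k1, k2, k3, k4, t1, t2, t3, t4] <;> simp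
  have hsub : ∀ r, stepMat l (r - 1) = stepMat l r * Sgen l := by
    intro r
    obtain ⟨k1, k2, k3, k4⟩ := stepMat_entries l r
    obtain ⟨m1, m2, m3, m4⟩ := stepMat_entries l (r - 1)
    apply SL2R.ext_entries <;> rw [SL2R.mul_entry] <;>
      simp only [k1, k2, k3, k4, m1, m2, m3, m4] <;> simp [Sgen]
    ring
  induction r with
  | zero => rw [h0]; exact inv_mem hT
  | succ i ih =>
    have := hsub (i + 1)
    rw [add_sub_cancel_right] at this
    rw [eq_mul_inv_of_mul_eq this.symm]
    exact mul_mem ih (inv_mem hS)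
  | pred i ih => rw [hsub]; exact mul_mem ih hS

lemma mobius_stepMat (l y : ℝ) (r : ℤ) : mobius (stepMat l r).1 y = 1 / (r * l - y) := by
  obtain ⟨k1, k2, k3, k4⟩ := stepMat_entries l r
  rw [mobius, k1, k2, k3, k4, zero_mul, zero_add, show -1 * y + r * l = r * l - y by ring]

lemma IsHypFixedPt.cqNext {p : ℕ} (hp : 3 ≤ p) {x : ℝ} (h : IsHypFixedPt (heckeLambda p) x) :
    IsHypFixedPt (heckeLambda p) (cqNext (heckeLambda p) x) := by
  have hl := one_le_heckeLambda hp
  have h1 := floor_add_one_mul_sub_pos (show 0 < heckeLambda p by linarith) x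
  obtain ⟨-, -, k3, k4⟩ := stepMat_entries (heckeLambda p) (⌊x / heckeLambda p⌋ + 1)
  have := h.mobius (stepMat_mem_heckeGroup (heckeLambda p) (⌊x / heckeLambda p⌋ + 1)) (by
    rw [k3, k4]
    push_cast
    exact ne_of_gt (by linarith))
  rw [mobius_stepMat] at this
  push_cast at this
  exact this

/-- The step of the continued fraction algorithm on pairs: the matrix determined by the first
coordinate is applied to both. -/
def pairNext (l : ℝ) (z : ℝ × ℝ) : ℝ × ℝ :=
  (cqNext l z.1, 1 / (((⌊z.1 / l⌋ : ℝ) + 1) * l - z.2))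

lemma pairNext_eq_mobius (l : ℝ) (z : ℝ × ℝ) :
    pairNext l z = (mobius (stepMat l (⌊z.1 / l⌋ + 1)).1 z.1,
      mobius (stepMat l (⌊z.1 / l⌋ + 1)).1 z.2) := by
  simp [pairNext, cqNext, mobius_stepMat]

lemma pairNext_iterate_fst (l : ℝ) (z : ℝ × ℝ) (j : ℕ) :
    ((pairNext l)^[j] z).1 = cq l z.1 j := by
  induction j with
  | zero => rfl
  | succ j ih => rw [Function.iterate_succ_apply', cq_succ, ← ih]; rfl

lemma IsFixedPair.pairNext {p : ℕ} (hp : 3 ≤ p) {t : ℝ} {z : ℝ × ℝ}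
    (h : IsFixedPair (heckeLambda p) t z.1 z.2)
    (hz : 0 < ((⌊z.1 / heckeLambda p⌋ : ℝ) + 1) * heckeLambda p - z.2) :
    IsFixedPair (heckeLambda p) t (pairNext (heckeLambda p) z).1
      (pairNext (heckeLambda p) z).2 := by
  have hl := one_le_heckeLambda hp
  have h1 := floor_add_one_mul_sub_pos (show 0 < heckeLambda p by linarith) z.1
  obtain ⟨-, -, k3, k4⟩ := stepMat_entries (heckeLambda p) (⌊z.1 / heckeLambda p⌋ + 1)
  push_cast at k4
  rw [pairNext_eq_mobius]
  refine h.mobius (stepMat_mem_heckeGroup _ _) ?_ ?_ <;> rw [k3, k4] <;>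
    · refine ne_of_gt ?_
      linarith

/-- `z.1` lies in `[U ^ (n + 2) (0), U ^ (n + 1) (0))` and `z.2 ≤ U ^ (n + 2) (0)`. -/
structure InRegion (p n : ℕ) (z : ℝ × ℝ) : Prop where
  level : InLevel p n z.1
  snd_le : z.2 ≤ Uorbit (heckeLambda p) (n + 2)

namespace InRegion

variable {p n : ℕ} {z : ℝ × ℝ}

lemma pos (hp : 3 ≤ p) (h : InRegion p n z) :
    0 < ((⌊z.1 / heckeLambda p⌋ : ℝ) + 1) * heckeLambda p - z.2 := by
  have hl := one_le_heckeLambda hp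
  have := floor_add_one_mul_sub_pos (show 0 < heckeLambda p by linarith) z.1
  have := h.level.lower
  have := h.snd_le
  linarith

lemma pairNext_snd_pos (hp : 3 ≤ p) (h : InRegion p n z) :
    0 < (pairNext (heckeLambda p) z).2 :=
  one_div_pos.2 (h.pos hp)

lemma pairNext (hp : 3 ≤ p) (h : InRegion p n z) :
    ∃ n', InRegion p n' (pairNext (heckeLambda p) z) := by
  have hl := one_le_heckeLambda hp
  have hpos := h.pos hp
  have hle := h.level.le
  have hsnd := h.snd_le
  rcases n with _ | n
  · obtain ⟨n', hn'⟩ := exists_inLevel hp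
      (inv_le_cqNext (show 0 < heckeLambda p by linarith) z.1)
    refine ⟨n', hn', le_trans ?_ (inv_le_Uorbit hp hn'.le)⟩
    have hf : (1 : ℝ) ≤ ⌊z.1 / heckeLambda p⌋ := by exact_mod_cast h.level.one_le_floor hp
    rw [zero_add, Uorbit_two hp] at hsnd
    refine one_div_le_one_div_of_le (by linarith) ?_
    nlinarith
  · refine ⟨n, h.level.cqNext hp, ?_⟩
    have hr := Uorbit_rec hp (n := n) (by omega)
    have hu := Uorbit_pos hp (n := n) (by omega)
    change 1 / _ ≤ _
    rw [h.level.floor_eq_zero hp, Int.cast_zero, zero_add, one_mul] at hpos ⊢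
    rw [one_div_le hpos hu]
    linarith

lemma iterate (hp : 3 ≤ p) (h : InRegion p n z) (j : ℕ) :
    ∃ n', InRegion p n' ((_root_.pairNext (heckeLambda p))^[j] z) := by
  induction j with
  | zero => exact ⟨n, h⟩
  | succ j ih =>
    obtain ⟨n', hn'⟩ := ih
    rw [Function.iterate_succ_apply']
    exact hn'.pairNext hp

lemma iterate_succ_snd_pos (hp : 3 ≤ p) (h : InRegion p n z) (j : ℕ) :
    0 < ((_root_.pairNext (heckeLambda p))^[j + 1] z).2 := by
  obtain ⟨n', hn'⟩ := h.iterate hp j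
  rw [Function.iterate_succ_apply']
  exact hn'.pairNext_snd_pos hp

lemma isFixedPair_iterate (hp : 3 ≤ p) {t : ℝ} (h : InRegion p n z)
    (hz : IsFixedPair (heckeLambda p) t z.1 z.2) (j : ℕ) :
    IsFixedPair (heckeLambda p) t ((_root_.pairNext (heckeLambda p))^[j] z).1
      ((_root_.pairNext (heckeLambda p))^[j] z).2 := by
  induction j with
  | zero => exact hz
  | succ j ih =>
    obtain ⟨n', hn'⟩ := h.iterate hp j
    rw [Function.iterate_succ_apply']
    exact ih.pairNext hp (hn'.pos hp)

lemma lt (hp : 3 ≤ p) {t : ℝ} (ht : 2 < t) (h : InRegion p n z)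
    (hz : IsFixedPair (heckeLambda p) t z.1 z.2) :
    z.2 < Uorbit (heckeLambda p) (n + 2) ∧ Uorbit (heckeLambda p) (n + 2) < z.1 :=
  ⟨h.snd_le.lt_of_ne ((hz.symm.isHypFixedPt ht).ne_Uorbit hp h.level.le),
    h.level.lower.lt_of_ne' ((hz.isHypFixedPt ht).ne_Uorbit hp h.level.le)⟩

lemma finite_isFixedPair (hp : 3 ≤ p) {t : ℝ} (ht : 2 < t) (n : ℕ) :
    {z : ℝ × ℝ | IsFixedPair (heckeLambda p) t z.1 z.2 ∧ InRegion p n z}.Finite := by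
  refine Set.Finite.of_finite_image (f := fun z => (mobius (posMat p hp n)⁻¹.1 z.1,
    mobius (posMat p hp n)⁻¹.1 z.2)) ((IsFixedPair.finite hp ht).subset ?_) ?_
  all_goals
    obtain ⟨i1, i2, i3, i4⟩ := SL2R.inv_entries (posMat p hp n)
    obtain ⟨k1, k2, k3, k4⟩ := posMat_entries p hp n
    have hdet := sinRatio_det hp n
    have hden : ∀ z : ℝ × ℝ, IsFixedPair (heckeLambda p) t z.1 z.2 → InRegion p n z →
        (sinRatio p (n + 1) * z.2 < sinRatio p (n + 2) ∧
          sinRatio p (n + 2) < sinRatio p (n + 1) * z.1) ∧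
        0 < -sinRatio p n * z.1 + sinRatio p (n + 1) ∧
        0 < -sinRatio p n * z.2 + sinRatio p (n + 1) := by
      intro z hz h
      obtain ⟨h1, h2⟩ := h.lt hp ht hz
      have hle := h.level.le
      have hs := one_le_sinRatio hp (n := n + 1) (by omega) (by omega)
      have hs0 : 0 < sinRatio p (n + 1) := by linarith
      rw [Uorbit_succ hp, lt_div_iff₀ hs0] at h1
      rw [Uorbit_succ hp, div_lt_iff₀ hs0] at h2
      have hz1 : 0 < -sinRatio p n * z.1 + sinRatio p (n + 1) := by
        rcases n with _ | n
        · simpa [sinRatio_zero] using hs0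
        · have hu := h.level.upper.resolve_left (by omega)
          have hs' := one_le_sinRatio hp (n := n + 1) (by omega) (by omega)
          rw [Uorbit_succ hp, lt_div_iff₀ (by linarith)] at hu
          linarith
      have hzz : z.2 < z.1 := by nlinarith
      have hn := sinRatio_nonneg hp (n := n) (by omega)
      exact ⟨⟨by linarith, by linarith⟩, hz1, by nlinarith⟩
  · rintro _ ⟨z, ⟨hz, h⟩, rfl⟩
    obtain ⟨⟨h1, h2⟩, h3, h4⟩ := hden z hz h
    refine ⟨hz.mobius (inv_mem (posMat_mem_heckeGroup hp n)) ?_ ?_, ?_, ?_⟩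
    · rw [i3, i4, k3, k1]; exact h3.ne'
    · rw [i3, i4, k3, k1]; exact h4.ne'
    · change mobius _ _ < 0
      rw [mobius, i1, i2, i3, i4, k1, k2, k3, k4]
      exact div_neg_of_neg_of_pos (by linarith) h4
    · change 0 < mobius _ _
      rw [mobius, i1, i2, i3, i4, k1, k2, k3, k4]
      exact div_pos (by linarith) h3
  · rintro z ⟨hz, h⟩ z' ⟨hz', h'⟩ heq
    obtain ⟨-, h3, h4⟩ := hden z hz h
    obtain ⟨-, h3', h4'⟩ := hden z' hz' h'
    simp only [mobius, i1, i2, i3, i4, k1, k2, k3, k4, Prod.mk.injEq] at heq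
    rw [div_eq_div_iff h3.ne' h3'.ne', div_eq_div_iff h4.ne' h4'.ne'] at heq
    obtain ⟨e1, e2⟩ := heq
    refine Prod.ext ?_ ?_
    · linear_combination e1 - (z.1 - z'.1) * hdet
    · linear_combination e2 - (z.2 - z'.2) * hdet

lemma pairNext_injOn (hp : 3 ≤ p) {n' : ℕ} {z' : ℝ × ℝ} (h : InRegion p n z)
    (h' : InRegion p n' z') (h0 : 0 < z.2) (h0' : 0 < z'.2)
    (hlt : z.2 < Uorbit (heckeLambda p) (n + 2)) (hlt' : z'.2 < Uorbit (heckeLambda p) (n' + 2))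
    (heq : _root_.pairNext (heckeLambda p) z = _root_.pairNext (heckeLambda p) z') : z = z' := by
  have hl := one_le_heckeLambda hp
  have hu := Uorbit_le_heckeLambda hp (n := n) (by have := h.level.le; omega)
  have hu' := Uorbit_le_heckeLambda hp (n := n') (by have := h'.level.le; omega)
  simp only [_root_.pairNext, _root_.cqNext, Prod.mk.injEq, one_div, _root_.inv_inj] at heq
  obtain ⟨e1, e2⟩ := heq
  have hf : ⌊z.1 / heckeLambda p⌋ = ⌊z'.1 / heckeLambda p⌋ := by
    generalize ⌊z.1 / heckeLambda p⌋ = a at *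
    generalize ⌊z'.1 / heckeLambda p⌋ = b at *
    have h1 : (a : ℝ) < b + 1 := by nlinarith
    have h2 : (b : ℝ) < a + 1 := by nlinarith
    have h1' : a < b + 1 := by exact_mod_cast h1
    have h2' : b < a + 1 := by exact_mod_cast h2
    omega
  rw [hf] at e1 e2
  exact Prod.ext (by linarith) (by linarith)

lemma exists_iterate_eq (hp : 3 ≤ p) {t : ℝ} (ht : 2 < t) (h : InRegion p n z) (h0 : 0 < z.2)
    (hz : IsFixedPair (heckeLambda p) t z.1 z.2) :
    ∃ m, 1 ≤ m ∧ (_root_.pairNext (heckeLambda p))^[m] z = z := by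
  set E := {z : ℝ × ℝ | IsFixedPair (heckeLambda p) t z.1 z.2 ∧ 0 < z.2 ∧ ∃ n, InRegion p n z}
    with hE
  have hfin : E.Finite := by
    refine ((Set.finite_Iic p).biUnion fun n _ => finite_isFixedPair hp ht n).subset ?_
    rintro z ⟨hz, -, n, hn⟩
    rw [Set.mem_iUnion₂]
    exact ⟨n, by have := hn.level.le; simp; omega, hz, hn⟩
  have hmaps : Set.MapsTo (_root_.pairNext (heckeLambda p)) E E := by
    rintro z ⟨hz, -, n, hn⟩
    exact ⟨hz.pairNext hp (hn.pos hp), hn.pairNext_snd_pos hp, hn.pairNext hp⟩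
  have hinj : Set.InjOn (_root_.pairNext (heckeLambda p)) E := by
    rintro z ⟨hz, h0, n, hn⟩ z' ⟨hz', h0', n', hn'⟩ heq
    exact hn.pairNext_injOn hp hn' h0 h0' (hn.lt hp ht hz).1 (hn'.lt hp ht hz').1 heq
  have : Finite E := hfin
  obtain ⟨m, hm, hper⟩ := Function.mem_periodicPts.1
    ((hmaps.restrict_inj.2 hinj).mem_periodicPts ⟨z, hz, h0, n, h⟩)
  refine ⟨m, hm, ?_⟩
  have := congrArg Subtype.val hper.eq
  rwa [hmaps.iterate_restrict] at this

end InRegion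

lemma SL2R.mul_denom {A B : SL2R} {x : ℝ} (hB : B.1 1 0 * x + B.1 1 1 ≠ 0) :
    (A * B).1 1 0 * x + (A * B).1 1 1 =
      (A.1 1 0 * mobius B.1 x + A.1 1 1) * (B.1 1 0 * x + B.1 1 1) := by
  rw [SL2R.mul_entry, SL2R.mul_entry, mobius]
  field_simp
  ring

lemma SL2R.mobius_mul {A B : SL2R} {x : ℝ} (hB : B.1 1 0 * x + B.1 1 1 ≠ 0) :
    mobius (A * B).1 x = mobius A.1 (mobius B.1 x) := by
  have h : (A * B).1 0 0 * x + (A * B).1 0 1 =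
      (A.1 0 0 * mobius B.1 x + A.1 0 1) * (B.1 1 0 * x + B.1 1 1) := by
    rw [SL2R.mul_entry, SL2R.mul_entry, mobius]
    field_simp
    ring
  rw [mobius.eq_def (A * B).1, SL2R.mul_denom hB, h, mul_div_mul_right _ _ hB,
    mobius.eq_def A.1]

lemma exists_iterate_eq_mobius (l x : ℝ) (j : ℕ) : ∃ N ∈ heckeGroup l, ∀ y,
    (∀ i, 0 < ((⌊((pairNext l)^[i] (x, y)).1 / l⌋ : ℝ) + 1) * l - ((pairNext l)^[i] (x, y)).2) →
    0 < N.1 1 0 * y + N.1 1 1 ∧ ((pairNext l)^[j] (x, y)).2 = mobius N.1 y := by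
  induction j with
  | zero => exact ⟨1, one_mem _, fun y _ => by simp [mobius]⟩
  | succ j ih =>
    obtain ⟨N, hN, h⟩ := ih
    refine ⟨stepMat l (⌊cq l x j / l⌋ + 1) * N, mul_mem (stepMat_mem_heckeGroup _ _) hN,
      fun y hy => ?_⟩
    obtain ⟨h1, h2⟩ := h y hy
    have hyj := hy j
    have hfst : ((pairNext l)^[j] (x, y)).1 = cq l x j := pairNext_iterate_fst l (x, y) j
    rw [SL2R.mul_denom h1.ne', SL2R.mobius_mul h1.ne', ← h2, Function.iterate_succ_apply',
      pairNext_eq_mobius, hfst]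
    rw [hfst] at hyj
    obtain ⟨-, -, k3, k4⟩ := stepMat_entries l (⌊cq l x j / l⌋ + 1)
    refine ⟨mul_pos ?_ h1, rfl⟩
    rw [k3, k4]
    push_cast
    linarith

/-- A hyperbolic fixed point in `[λ, ∞)` with a purely periodic expansion has its conjugate
below `λ`. -/
lemma exists_isFixedPair_of_cq_eq {p : ℕ} (hp : 3 ≤ p) {x : ℝ} (hx : InLevel p 0 x)
    (hyp : IsHypFixedPt (heckeLambda p) x) {m : ℕ} (hm : 1 ≤ m)
    (hper : cq (heckeLambda p) x m = x) :
    ∃ t y, 2 < t ∧ IsFixedPair (heckeLambda p) t x y ∧ y ≤ heckeLambda p := by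
  have hl := one_le_heckeLambda hp
  have hl0 : 0 < heckeLambda p := by linarith
  have hu2 := Uorbit_two hp
  obtain ⟨N, hN, h⟩ := exists_iterate_eq_mobius (heckeLambda p) x m
  have hreg : ∀ y ≤ heckeLambda p, InRegion p 0 (x, y) := fun y hy =>
    ⟨hx, by rwa [zero_add, hu2]⟩
  have hden : ∀ y ≤ heckeLambda p, 0 < N.1 1 0 * y + N.1 1 1 ∧
      0 < mobius N.1 y ∧ mobius N.1 y ≤ heckeLambda p := by
    intro y hy
    obtain ⟨h1, h2⟩ := h y fun i => by
      obtain ⟨n', hn'⟩ := (hreg y hy).iterate hp i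
      exact hn'.pos hp
    refine ⟨h1, ?_, ?_⟩ <;> rw [← h2]
    · obtain ⟨m, rfl⟩ := Nat.exists_eq_add_of_le' hm
      exact (hreg y hy).iterate_succ_snd_pos hp m
    · obtain ⟨n', hn'⟩ := (hreg y hy).iterate hp m
      have hn0 : n' = 0 := by
        refine hn'.level.unique hp ?_
        rw [pairNext_iterate_fst, hper]
        exact hx
      have := hn'.snd_le
      rwa [hn0, zero_add, hu2] at this
  have hdiag : ∀ i, ((pairNext (heckeLambda p))^[i] (x, x)).2 =
      ((pairNext (heckeLambda p))^[i] (x, x)).1 := by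
    intro i
    induction i with
    | zero => rfl
    | succ i ih =>
      rw [Function.iterate_succ_apply', pairNext, cqNext, ih]
  obtain ⟨hx1, hx2⟩ := h x fun i => by
    rw [hdiag]
    exact floor_add_one_mul_sub_pos hl0 _
  rw [hdiag, pairNext_iterate_fst, hper, mobius, eq_div_iff hx1.ne'] at hx2
  obtain ⟨hd0, hb0, -⟩ := hden 0 hl0.le
  obtain ⟨hdl, -, hbl⟩ := hden _ le_rfl
  rw [mobius, mul_zero, mul_zero, zero_add, zero_add] at hb0
  rw [mul_zero, zero_add] at hd0
  rw [mobius, div_le_iff₀ hdl] at hbl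
  have hb : 0 < N.1 0 1 := (div_pos_iff_of_pos_right hd0).1 hb0
  have hfx : fixesQuad N x := by
    unfold fixesQuad
    linear_combination hx2
  have hivt := intermediate_value_Icc hl0.le (f := fun y => N.1 1 0 * y ^ 2 +
    (N.1 1 1 - N.1 0 0) * y - N.1 0 1) (by fun_prop)
  obtain ⟨y, ⟨hy0, hyl⟩, hy⟩ := hivt (show (0 : ℝ) ∈ Set.Icc _ _ from
    ⟨by linarith, by linarith⟩)
  have hfy : fixesQuad N y := hy
  have hlx : heckeLambda p < x := by
    have h1 := hx.lower
    have h2 := hyp.ne_Uorbit hp (n := 0) (by omega)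
    rw [zero_add, hu2] at h1 h2
    exact h1.lt_of_ne' h2
  have hyx : y < x := hyl.trans_lt hlx
  obtain ⟨e1, e2⟩ := fixesQuad_relations hfx hfy hyx.ne
  have hc : N.1 1 0 ≠ 0 := by
    intro h0
    rw [h0] at e2
    linarith
  obtain ⟨hdy, -⟩ := hden y hyl
  have hdet := SL2R.det_eq N
  rw [e1, e2] at hdet
  have hprod : (N.1 1 0 * x + N.1 1 1) * (N.1 1 0 * y + N.1 1 1) = 1 := by
    linear_combination hdet
  have hne : N.1 1 0 * x + N.1 1 1 ≠ N.1 1 0 * y + N.1 1 1 := by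
    intro h
    have : N.1 1 0 * (x - y) = 0 := by linear_combination h
    rcases mul_eq_zero.1 this with h | h
    · exact hc h
    · linarith
  refine ⟨_, y, ?_, ⟨N, hN, rfl, hfx, hfy, hyx.ne⟩, hyl⟩
  refine lt_of_lt_of_le ?_ (le_abs_self _)
  have := sub_ne_zero.2 hne
  have := sq_pos_of_ne_zero this
  rw [e1]
  nlinarith

lemma add_three_le_of_isLeast {p : ℕ} (hp : 3 ≤ p) {x y : ℝ} {k : ℕ} (hy : 0 < y)
    (hyk : y < Uorbit (heckeLambda p) (k + 2)) (hkx : Uorbit (heckeLambda p) (k + 2) < x)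
    (hxk : k = 0 ∨ x < Uorbit (heckeLambda p) (k + 1))
    (hmin : ∀ j < k, ¬ (0 < y ∧ y < Uorbit (heckeLambda p) (j + 2) ∧
      Uorbit (heckeLambda p) (j + 2) < x ∧
      (j = 0 ∨ x < Uorbit (heckeLambda p) (j + 1)))) : k + 3 ≤ p := by
  by_contra hk
  rcases (show k + 2 = p ∨ k + 1 = p ∨ p ≤ k by omega) with h | h | h
  · rw [h, Uorbit_self hp] at hyk
    linarith
  · rw [← h, Uorbit_succ_self (p := k + 1) (by omega)] at hyk
    linarith
  · obtain ⟨j, rfl⟩ := Nat.exists_eq_add_of_le' h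
    rw [show j + p + 2 = j + 2 + p by ring, Uorbit_add_self hp] at hyk hkx
    rw [show j + p + 1 = j + 1 + p by ring, Uorbit_add_self hp] at hxk
    exact hmin j (by omega) ⟨hy, hyk, hkx, Or.inr (hxk.resolve_left (by omega))⟩

/-- a hyperbolic fixed point `α` (with Hecke conjugate `α'`) is
`G_p`-reduced with exactly `k` leading ones in its `λ`-CF iff `k` is the
smallest nonnegative integer with `0 < α' < U^{k+2}(0) < α < U^{k+1}(0)`
(for `k = 0` the last inequality is vacuous since `U(0) = ∞`). -/
theorem hecke_reduced_characterization (p : ℕ) (hp : 3 ≤ p) (α α' : ℝ)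
    (hpair : IsHypPair (heckeLambda p) α α') (k : ℕ) :
    ((∃ m : ℕ, 1 ≤ m ∧ cq (heckeLambda p) α m = α) ∧
        (∀ j : ℕ, j < k → pq (heckeLambda p) α j = 1) ∧
        2 ≤ pq (heckeLambda p) α k) ↔
      ((0 < α' ∧ α' < Uorbit (heckeLambda p) (k + 2) ∧
          Uorbit (heckeLambda p) (k + 2) < α ∧
          (k = 0 ∨ α < Uorbit (heckeLambda p) (k + 1))) ∧
        ∀ j : ℕ, j < k →
          ¬ (0 < α' ∧ α' < Uorbit (heckeLambda p) (j + 2) ∧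
              Uorbit (heckeLambda p) (j + 2) < α ∧
              (j = 0 ∨ α < Uorbit (heckeLambda p) (j + 1)))) := by
  obtain ⟨t, ht, hfix⟩ := hpair.exists_isFixedPair
  have hl := one_le_heckeLambda hp
  constructor
  · rintro ⟨⟨m, hm, hper⟩, hone, htwo⟩
    have hlow : 1 / heckeLambda p ≤ α := by
      obtain ⟨m, rfl⟩ := Nat.exists_eq_add_of_le' hm
      rw [← hper, cq_succ]
      exact inv_le_cqNext (by linarith) _
    obtain ⟨n, hn⟩ := exists_inLevel hp hlow
    obtain rfl := hn.eq_of_pq hp hone htwo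
    have hβ := hn.cq hp le_rfl
    rw [Nat.sub_self] at hβ
    have hβhyp : ∀ j, IsHypFixedPt (heckeLambda p) (cq (heckeLambda p) α j) := by
      intro j
      induction j with
      | zero => exact hfix.isHypFixedPt ht
      | succ j ih => exact ih.cqNext hp
    have hβper : cq (heckeLambda p) (cq (heckeLambda p) α n) m = cq (heckeLambda p) α n := by
      rw [← cq_add, add_comm, cq_add, hper]
    obtain ⟨t', y, ht', hy, hyl⟩ := exists_isFixedPair_of_cq_eq hp hβ (hβhyp n) hm hβper
    have hreg : InRegion p 0 (cq (heckeLambda p) α n, y) :=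
      ⟨hβ, by rwa [zero_add, Uorbit_two hp]⟩
    obtain ⟨s, hs⟩ : ∃ s, n + (s + 1) = m * (n + 1) := by
      refine ⟨m * (n + 1) - n - 1, ?_⟩
      have : 1 * (n + 1) ≤ m * (n + 1) := Nat.mul_le_mul_right _ hm
      omega
    have hfst : ((pairNext (heckeLambda p))^[s + 1] (cq (heckeLambda p) α n, y)).1 = α := by
      rw [pairNext_iterate_fst, ← cq_add, hs, cq_mul_of_eq hper]
    have hfix' := hreg.isFixedPair_iterate hp hy (s + 1)
    have hpos := hreg.iterate_succ_snd_pos hp s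
    obtain ⟨n', hn'⟩ := hreg.iterate hp (s + 1)
    have hlt := hn'.lt hp ht' hfix'
    have hlev := hn'.level
    rw [hfst] at hfix' hlt hlev
    rw [hfix'.unique hp ht' ht hfix] at hpos hlt
    obtain rfl := hlev.unique hp hn
    refine ⟨⟨hpos, hlt.1, hlt.2, hn.upper⟩, fun j hj h => ?_⟩
    have h1 := hn.upper.resolve_left (by omega)
    obtain ⟨i, rfl⟩ : ∃ i, n' = i + 1 := ⟨n' - 1, by omega⟩
    have h2 := Uorbit_anti hp (m := j) (n := i) (by omega) (by have := hn.le; omega)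
    exact absurd h.2.2.1 (not_lt.2 (h1.le.trans h2))
  · rintro ⟨⟨hpos, hlt, hlt', hup⟩, hmin⟩
    have hlev : InLevel p k α :=
      ⟨add_three_le_of_isLeast hp hpos hlt hlt' hup hmin, hlt'.le, hup⟩
    obtain ⟨m, hm, hper⟩ :=
      InRegion.exists_iterate_eq hp ht (z := (α, α')) ⟨hlev, hlt.le⟩ hpos hfix
    refine ⟨⟨m, hm, ?_⟩, fun j hj => hlev.pq_eq_one hp hj, hlev.two_le_pq hp⟩
    rw [← pairNext_iterate_fst (heckeLambda p) (α, α'), hper]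
end
end

section
/- Fix an integer p ≥ 3 and let λ = 2cos(π/p). Let α be a hyperbolic fixed point of the Hecke group G_p, with complete-quotient sequence (α_j). Then there exists n ≥ 0 such that α_n is G_p-reduced, i.e. the complete-quotient sequence of α_n is purely periodic; equivalently, finitely many applications of the map x ↦ TS^{−r}x with r = ⌊x/λ⌋ + 1 transform α into a G_p-reduced number. Moreover, if β is G_p-reduced with first partial quotient r, then TS^{−r}β is again G_p-reduced. -/
open Real Matrix Filter

noncomputable section

/-- The projective lift of one step of the `λ`-continued fraction algorithm to `ℝ²`: on vectors
`(x, y)` with `y ≠ 0` it induces `α ↦ 1 / (rλ - α)` on the ratio `α = x / y`. -/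
def cqLift (l : ℝ) (v : ℝ × ℝ) : ℝ × ℝ :=
  (v.2, ((⌊v.1 / v.2 / l⌋ : ℝ) + 1) * l * v.2 - v.1)

/-- Two vectors are tail equivalent when their `cqLift`-orbits eventually meet, up to sign. -/
def TailEquiv (l : ℝ) (v w : ℝ × ℝ) : Prop :=
  ∃ m n : ℕ, ∃ e : ℝ, (e = 1 ∨ e = -1) ∧ (cqLift l)^[m] v = e • (cqLift l)^[n] w

/-- The linear action of `SL(2, ℝ)` on `ℝ²`. -/
def actPair (g : Matrix.SpecialLinearGroup (Fin 2) ℝ) (v : ℝ × ℝ) : ℝ × ℝ :=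
  (g.1 0 0 * v.1 + g.1 0 1 * v.2, g.1 1 0 * v.1 + g.1 1 1 * v.2)

lemma cqLift_smul (l : ℝ) {c : ℝ} (hc : c ≠ 0) (v : ℝ × ℝ) :
    cqLift l (c • v) = c • cqLift l v := by
  have h : (c * v.1) / (c * v.2) = v.1 / v.2 := mul_div_mul_left _ _ hc
  simp only [cqLift, Prod.smul_fst, Prod.smul_snd, smul_eq_mul, h, Prod.smul_mk]
  ext
  · rfl
  · simp only []; ring

lemma cqLift_iterate_smul (l : ℝ) {c : ℝ} (hc : c ≠ 0) (v : ℝ × ℝ) (n : ℕ) :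
    (cqLift l)^[n] (c • v) = c • (cqLift l)^[n] v := by
  induction n generalizing v with
  | zero => rfl
  | succ n ih => rw [Function.iterate_succ_apply, Function.iterate_succ_apply, cqLift_smul l hc, ih]

namespace TailEquiv

variable {l : ℝ} {u v w : ℝ × ℝ}

lemma refl (v : ℝ × ℝ) : TailEquiv l v v := ⟨0, 0, 1, Or.inl rfl, by simp⟩

lemma symm (h : TailEquiv l v w) : TailEquiv l w v := by
  obtain ⟨m, n, e, he, h⟩ := h
  refine ⟨n, m, e, he, ?_⟩
  rw [h, smul_smul]
  rcases he with rfl | rfl <;> simp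

lemma trans (h₁ : TailEquiv l u v) (h₂ : TailEquiv l v w) : TailEquiv l u w := by
  obtain ⟨m, n, e, he, h⟩ := h₁
  obtain ⟨m', n', e', he', h'⟩ := h₂
  have he0 : e ≠ 0 := by rcases he with rfl | rfl <;> norm_num
  have he0' : e' ≠ 0 := by rcases he' with rfl | rfl <;> norm_num
  refine ⟨m' + m, n + n', e * e', ?_, ?_⟩
  · rcases he with rfl | rfl <;> rcases he' with rfl | rfl <;> norm_num
  · rw [Function.iterate_add_apply, h, cqLift_iterate_smul l he0, ← Function.iterate_add_apply,
      add_comm m' n, Function.iterate_add_apply, h', cqLift_iterate_smul l he0', smul_smul,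
      ← Function.iterate_add_apply]

lemma neg_right (h : TailEquiv l v w) : TailEquiv l v (-w) :=
  h.trans ⟨0, 0, -1, Or.inr rfl, by simp⟩

lemma of_iterate {n : ℕ} (h : (cqLift l)^[n] v = w) : TailEquiv l v w :=
  ⟨n, 0, 1, Or.inl rfl, by simpa using h⟩

lemma translate (hl : 0 < l) (x y : ℝ) : TailEquiv l (x, y) (x + l * y, y) := by
  refine ⟨1, 1, 1, Or.inl rfl, ?_⟩
  rcases eq_or_ne y 0 with rfl | hy
  · simp [cqLift]
  · have h : (x + l * y) / y / l = x / y / l + 1 := by field_simp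
    simp only [Function.iterate_one, cqLift, h, Int.floor_add_one, one_smul]
    ext
    · rfl
    · push_cast; ring

end TailEquiv

lemma heckeLambda_pos {p : ℕ} (hp : 3 ≤ p) : 0 < heckeLambda p := by
  have hp' : (3 : ℝ) ≤ p := by exact_mod_cast hp
  have h : 0 < Real.cos (Real.pi / p) := by
    apply Real.cos_pos_of_mem_Ioo
    constructor
    · have : 0 < Real.pi / p := by positivity
      linarith [Real.pi_pos]
    · exact div_lt_div_of_pos_left Real.pi_pos (by norm_num) (by linarith)
  unfold heckeLambda
  linarith

lemma cqLift_of_lt {l x y : ℝ} (hl : 0 < l) (hx : 0 ≤ x) (hy : 0 < y) (h : x < l * y) :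
    cqLift l (x, y) = (y, l * y - x) := by
  have : ⌊x / y / l⌋ = 0 := by
    rw [Int.floor_eq_zero_iff]
    refine ⟨by positivity, ?_⟩
    rw [div_lt_one hl, div_lt_iff₀ hy]
    exact h
  simp [cqLift, this]

/-- The first `p - 2` partial quotients of a ratio in `(0, 1/λ)` all equal `1`. -/
lemma cqLift_iterate_sin {p : ℕ} (hp : 3 ≤ p) {x y : ℝ} (hx : 0 < x)
    (hxy : heckeLambda p * x < y) {k : ℕ} (hk : k + 2 ≤ p) :
    (cqLift (heckeLambda p))^[k] (x, y) =
      ((y * Real.sin (k * (π / p)) - x * Real.sin (k * (π / p) - π / p)) / Real.sin (π / p),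
        (y * Real.sin (k * (π / p) + π / p) - x * Real.sin (k * (π / p))) / Real.sin (π / p)) := by
  have hp0 : (0 : ℝ) < p := by exact_mod_cast (by omega : 0 < p)
  have hpos : 0 < π / p := by positivity
  have hpp : (p : ℝ) * (π / p) = π := by field_simp
  have hs : 0 < Real.sin (π / p) := by
    apply Real.sin_pos_of_pos_of_lt_pi hpos
    exact div_lt_self Real.pi_pos (by exact_mod_cast (by omega : 1 < p))
  have hl := heckeLambda_pos hp
  have sin_rec (t : ℝ) : Real.sin (t + π / p) =
      heckeLambda p * Real.sin t - Real.sin (t - π / p) := by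
    rw [Real.sin_add, Real.sin_sub, heckeLambda]; ring
  have pos (j : ℕ) (hj : j < p) :
      0 < (y * Real.sin (j * (π / p)) - x * Real.sin (j * (π / p) - π / p)) / Real.sin (π / p) := by
    apply div_pos _ hs
    rcases Nat.eq_zero_or_pos j with rfl | hj0
    · simp; positivity
    · have hj1 : (0 : ℝ) < j := by exact_mod_cast hj0
      have hjp : (j : ℝ) + 1 ≤ p := by exact_mod_cast hj
      have h1 : 0 < Real.sin (j * (π / p)) := by
        apply Real.sin_pos_of_pos_of_lt_pi (by positivity)
        nlinarith
      have h2 : 0 ≤ Real.sin (j * (π / p) + π / p) := by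
        apply Real.sin_nonneg_of_nonneg_of_le_pi (by positivity)
        nlinarith
      rw [sin_rec] at h2
      nlinarith [mul_pos (sub_pos.2 hxy) h1, mul_nonneg hx.le h2]
  induction k with
  | zero => simp [hs.ne']
  | succ k ih =>
    have h0 := pos k (by omega)
    have h1 := pos (k + 1) (by omega)
    have h2 := pos (k + 2) (by omega)
    push_cast at h1 h2 ⊢
    have e1 : ((k : ℝ) + 1) * (π / p) = k * (π / p) + π / p := by ring
    have e2 : ((k : ℝ) + 2) * (π / p) = k * (π / p) + π / p + π / p := by ring
    rw [e1, add_sub_cancel_right] at h1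
    rw [e2, add_sub_cancel_right] at h2
    have h3 : (y * Real.sin (k * (π / p) + π / p + π / p) - x * Real.sin (k * (π / p) + π / p)) /
          Real.sin (π / p) =
        heckeLambda p * ((y * Real.sin (k * (π / p) + π / p) - x * Real.sin (k * (π / p))) /
          Real.sin (π / p)) -
        (y * Real.sin (k * (π / p)) - x * Real.sin (k * (π / p) - π / p)) / Real.sin (π / p) := by
      rw [sin_rec (k * (π / p) + π / p), add_sub_cancel_right, sin_rec (k * (π / p))]
      ring
    rw [Function.iterate_succ_apply', ih (by omega), cqLift_of_lt hl h0.le h1 (by linarith), e1,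
      add_sub_cancel_right, h3]

namespace TailEquiv

variable {p : ℕ}

lemma sub_lambda_mul (hp : 3 ≤ p) {x y : ℝ} (hx : 0 < x) (hxy : heckeLambda p * x < y) :
    TailEquiv (heckeLambda p) (x, y) (x, y - heckeLambda p * x) := by
  have hp0 : (0 : ℝ) < p := by exact_mod_cast (by omega : 0 < p)
  have hs : 0 < Real.sin (π / p) := by
    apply Real.sin_pos_of_pos_of_lt_pi (by positivity)
    exact div_lt_self Real.pi_pos (by exact_mod_cast (by omega : 1 < p))
  have h := cqLift_iterate_sin hp hx hxy (k := p - 2) (by omega)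
  have e : ((p - 2 : ℕ) : ℝ) * (π / p) = π - 2 * (π / p) := by
    rw [Nat.cast_sub (by omega)]; push_cast; field_simp
  have e1 : π - 2 * (π / p) + π / p = π - π / p := by ring
  have e2 : π - 2 * (π / p) - π / p = π - (2 * (π / p) + π / p) := by ring
  rw [e, e1, e2, Real.sin_pi_sub, Real.sin_pi_sub, Real.sin_pi_sub, Real.sin_add,
    Real.sin_two_mul, Real.cos_two_mul] at h
  refine (of_iterate h).trans (symm ?_)
  convert translate (heckeLambda_pos hp) x (y - heckeLambda p * x) using 2
  · unfold heckeLambda; field_simp; ring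
  · unfold heckeLambda; field_simp

lemma rotate_of_pos (hp : 3 ≤ p) {x : ℝ} (hx : 0 < x) (n : ℕ) :
    ∀ y : ℝ, 0 < y → y ≤ n * (heckeLambda p * x) →
      TailEquiv (heckeLambda p) (x, y) (-y, x) := by
  have hl := heckeLambda_pos hp
  induction n with
  | zero => intro y hy h; simp at h; linarith
  | succ n ih =>
    intro y hy h
    rcases le_or_gt y (heckeLambda p * x) with hle | hlt
    · refine symm (of_iterate (n := 1) ?_)
      have : ⌊-y / x / heckeLambda p⌋ = -1 := by
        rw [Int.floor_eq_iff, div_div, le_div_iff₀ (by positivity), div_lt_iff₀ (by positivity)]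
        constructor
        · push_cast; linarith
        · push_cast; linarith
      simp [cqLift, this]
    · push_cast at h
      refine (sub_lambda_mul hp hx hlt).trans
        ((ih _ (by linarith) (by linarith)).trans (symm ?_))
      convert translate hl (-y) x using 2
      ring

lemma rotate (hp : 3 ≤ p) (x y : ℝ) : TailEquiv (heckeLambda p) (x, y) (-y, x) := by
  have hl := heckeLambda_pos hp
  have key (x y : ℝ) (hx : 0 < x) (hy : 0 < y) : TailEquiv (heckeLambda p) (x, y) (-y, x) := by
    obtain ⟨n, hn⟩ := exists_nat_ge (y / (heckeLambda p * x))
    exact rotate_of_pos hp hx n y hy ((div_le_iff₀ (by positivity)).1 hn)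
  rcases lt_trichotomy x 0 with hx | rfl | hx <;> rcases lt_trichotomy y 0 with hy | rfl | hy
  · simpa using ((key (-x) (-y) (by linarith) (by linarith)).neg_right.symm.neg_right).symm
  · simpa using (of_iterate (n := 1) (l := heckeLambda p) (v := (x, 0)) (w := -(0, x))
      (by simp [cqLift])).neg_right
  · simpa using (key y (-x) hy (by linarith)).symm.neg_right
  · exact symm (of_iterate (n := 1) (by simp [cqLift]))
  · simpa using refl (l := heckeLambda p) (0, 0)
  · exact symm (of_iterate (n := 1) (by simp [cqLift]))
  · simpa using (key (-y) x (by linarith) hx).neg_right.symm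
  · simpa using (of_iterate (n := 1) (l := heckeLambda p) (v := (x, 0)) (w := -(0, x))
      (by simp [cqLift])).neg_right
  · exact key x y hx hy

lemma actPair (hp : 3 ≤ p) {g : Matrix.SpecialLinearGroup (Fin 2) ℝ}
    (hg : g ∈ heckeGroup (heckeLambda p)) (v : ℝ × ℝ) :
    TailEquiv (heckeLambda p) v (actPair g v) := by
  have comp (g h : Matrix.SpecialLinearGroup (Fin 2) ℝ) (v : ℝ × ℝ) :
      _root_.actPair (g * h) v = _root_.actPair g (_root_.actPair h v) := by
    simp only [_root_.actPair, Matrix.SpecialLinearGroup.coe_mul, Matrix.mul_apply,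
      Fin.sum_univ_two]
    ext <;> simp only [] <;> ring
  induction hg using Subgroup.closure_induction generalizing v with
  | mem g hg =>
    rcases hg with rfl | rfl
    · simpa [_root_.actPair, Sgen] using translate (heckeLambda_pos hp) v.1 v.2
    · simpa [_root_.actPair, Tgen] using rotate hp v.1 v.2
  | one => simpa [_root_.actPair] using refl v
  | mul g h _ _ ihg ihh => rw [comp]; exact (ihh v).trans (ihg _)
  | inv g _ ih =>
    have := ih (_root_.actPair g⁻¹ v)
    rw [← comp, mul_inv_cancel] at this
    simpa [_root_.actPair] using this.symm

end TailEquiv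

lemma cq_add_s13 (l α : ℝ) (m n : ℕ) : cq l (cq l α m) n = cq l α (m + n) := by
  induction n with
  | zero => rfl
  | succ n ih => rw [← add_assoc, cq, cq, ih]

lemma lt_floor_add_one_mul {l : ℝ} (hl : 0 < l) (x : ℝ) : x < ((⌊x / l⌋ : ℝ) + 1) * l :=
  (div_lt_iff₀ hl).1 (Int.lt_floor_add_one _)

lemma cqLift_iterate_cq {l : ℝ} (hl : 0 < l) (α : ℝ) (n : ℕ) :
    ∃ y : ℝ, 0 < y ∧ (cqLift l)^[n] (α, 1) = (cq l α n * y, y) := by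
  induction n with
  | zero => exact ⟨1, one_pos, by simp [cq]⟩
  | succ n ih =>
    obtain ⟨y, hy, h⟩ := ih
    have hlt := sub_pos.2 (lt_floor_add_one_mul hl (cq l α n))
    refine ⟨(((⌊cq l α n / l⌋ : ℝ) + 1) * l - cq l α n) * y, mul_pos hlt hy, ?_⟩
    rw [Function.iterate_succ_apply', h, cqLift, cq]
    simp only [mul_div_cancel_right₀ _ hy.ne']
    ext
    · rw [one_div, inv_mul_cancel_left₀ hlt.ne']
    · simp only []; ring

lemma IsHypFixedPt.conj {l α β : ℝ} {g : Matrix.SpecialLinearGroup (Fin 2) ℝ}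
    (hg : g ∈ heckeGroup l) (h : IsHypFixedPt l α)
    (hfix : ∀ M : Matrix.SpecialLinearGroup (Fin 2) ℝ, fixesQuad M α →
      fixesQuad (g * M * g⁻¹) β) : IsHypFixedPt l β := by
  obtain ⟨M, hM, htr, hq⟩ := h
  refine ⟨g * M * g⁻¹, mul_mem (mul_mem hg hM) (inv_mem hg), ?_, hfix M hq⟩
  have := Matrix.trace_mul_cycle g.1 M.1 (g⁻¹).1
  rw [← Matrix.SpecialLinearGroup.coe_mul (g⁻¹) g, inv_mul_cancel, Matrix.SpecialLinearGroup.coe_one,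
    one_mul, Matrix.trace_fin_two, Matrix.trace_fin_two] at this
  simpa only [Matrix.SpecialLinearGroup.coe_mul, this] using htr

lemma Sgen_inv_coe (l : ℝ) : (Sgen l)⁻¹.1 = !![1, -l; 0, 1] := by
  rw [Matrix.SpecialLinearGroup.coe_inv]
  exact (Matrix.adjugate_fin_two_of _ _ _ _).trans (by simp)

lemma Tgen_inv_coe : (Tgen⁻¹).1 = !![0, 1; -1, 0] := by
  rw [Matrix.SpecialLinearGroup.coe_inv]
  exact (Matrix.adjugate_fin_two_of _ _ _ _).trans (by simp)

lemma Sgen_coe (l : ℝ) : (Sgen l).1 = !![1, l; 0, 1] := rfl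

lemma Tgen_coe : Tgen.1 = !![0, -1; 1, 0] := rfl

lemma IsHypFixedPt.add_int_mul {l α : ℝ} (h : IsHypFixedPt l α) (k : ℤ) :
    IsHypFixedPt l (α + k * l) := by
  have hS : Sgen l ∈ heckeGroup l := Subgroup.subset_closure (by simp)
  have hadd (β : ℝ) (h : IsHypFixedPt l β) : IsHypFixedPt l (β + l) := by
    refine h.conj hS fun M hM => ?_
    simp only [fixesQuad, Matrix.SpecialLinearGroup.coe_mul, Sgen_coe, Sgen_inv_coe,
      Matrix.mul_apply, Fin.sum_univ_two] at hM ⊢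
    simp
    linear_combination hM
  have hsub (β : ℝ) (h : IsHypFixedPt l β) : IsHypFixedPt l (β - l) := by
    refine h.conj (inv_mem hS) fun M hM => ?_
    simp only [fixesQuad, inv_inv, Matrix.SpecialLinearGroup.coe_mul, Sgen_coe, Sgen_inv_coe,
      Matrix.mul_apply, Fin.sum_univ_two] at hM ⊢
    simp
    linear_combination hM
  induction k using Int.induction_on with
  | zero => simpa using h
  | succ i ih => convert hadd _ ih using 1; push_cast; ring
  | pred i ih => convert hsub _ ih using 1; push_cast; ring

lemma IsHypFixedPt.neg_inv {l α : ℝ} (h : IsHypFixedPt l α) (hα : α ≠ 0) :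
    IsHypFixedPt l (-α⁻¹) := by
  refine h.conj (g := Tgen) (Subgroup.subset_closure (by simp)) fun M hM => ?_
  simp only [fixesQuad, Matrix.SpecialLinearGroup.coe_mul, Tgen_coe, Tgen_inv_coe,
    Matrix.mul_apply, Fin.sum_univ_two] at hM ⊢
  simp
  field_simp
  linear_combination hM

lemma IsHypFixedPt.cq {l α : ℝ} (hl : 0 < l) (h : IsHypFixedPt l α) (n : ℕ) :
    IsHypFixedPt l (cq l α n) := by
  induction n with
  | zero => exact h
  | succ n ih =>
    have hlt := lt_floor_add_one_mul hl (_root_.cq l α n)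
    have := (ih.add_int_mul (-(⌊_root_.cq l α n / l⌋ + 1))).neg_inv (by push_cast; linarith)
    rw [_root_.cq]
    convert this using 1
    push_cast
    rw [← inv_neg, one_div]
    congr 1
    ring

/-- Complete quotients of a hyperbolic fixed point repeat. -/
lemma IsHypFixedPt.exists_cq_eq {p : ℕ} (hp : 3 ≤ p) {α : ℝ}
    (h : IsHypFixedPt (heckeLambda p) α) :
    ∃ m n : ℕ, m ≠ n ∧ _root_.cq (heckeLambda p) α m = _root_.cq (heckeLambda p) α n := by
  obtain ⟨M, hM, htr, hq⟩ := h
  unfold fixesQuad at hq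
  have hdet := M.2
  rw [Matrix.det_fin_two] at hdet
  set μ := M.1 1 0 * α + M.1 1 1 with hμ
  have hinv : μ * (M.1 0 0 - M.1 1 0 * α) = 1 := by
    rw [hμ]; linear_combination hdet - M.1 1 0 * hq
  have hμ0 : μ ≠ 0 := left_ne_zero_of_mul_eq_one hinv
  have hne (e : ℝ) (he : e = 1 ∨ e = -1) : e * μ ≠ 1 := by
    intro hc
    have htr' : M.1 0 0 + M.1 1 1 = μ + (M.1 0 0 - M.1 1 0 * α) := by rw [hμ]; ring
    rw [htr'] at htr
    rcases he with rfl | rfl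
    · have : μ = 1 := by linarith
      rw [this] at hinv htr
      rw [one_mul] at hinv
      norm_num [hinv] at htr
    · have h1 : μ = -1 := by linarith
      have h2 : M.1 0 0 - M.1 1 0 * α = -1 := by rw [h1] at hinv; linarith
      rw [h1, h2] at htr
      norm_num at htr
  have hact : actPair M (α, 1) = μ • ((α, 1) : ℝ × ℝ) := by
    simp only [actPair, Prod.smul_mk, smul_eq_mul, mul_one, hμ]
    ext
    · simp only []; linear_combination -hq
    · rfl
  obtain ⟨m, n, e, he, hmn⟩ := TailEquiv.actPair hp hM (α, 1)
  rw [hact, cqLift_iterate_smul _ hμ0, smul_smul] at hmn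
  obtain ⟨y, hy, h1⟩ := cqLift_iterate_cq (heckeLambda_pos hp) α m
  obtain ⟨z, hz, h2⟩ := cqLift_iterate_cq (heckeLambda_pos hp) α n
  refine ⟨m, n, ?_, ?_⟩
  · rintro rfl
    rw [h1, Prod.smul_mk, Prod.mk.injEq, smul_eq_mul, smul_eq_mul] at hmn
    exact hne e he (mul_right_cancel₀ hy.ne' (by linarith [hmn.2]))
  · rw [h1, h2, Prod.smul_mk, Prod.mk.injEq, smul_eq_mul, smul_eq_mul] at hmn
    apply mul_right_cancel₀ hy.ne'
    rw [hmn.1, hmn.2]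
    ring

/-- every hyperbolic fixed point of `G_p` is transformed into a
`G_p`-reduced number by finitely many applications of `x ↦ TS^{-r}x`,
`r = ⌊x/λ⌋ + 1` (i.e. some complete quotient `α_n` is reduced); and the map
`x ↦ TS^{-r}x` (i.e. `β ↦ β_1`) carries reduced numbers to reduced numbers. -/
theorem hecke_reduction (p : ℕ) (hp : 3 ≤ p) (α : ℝ)
    (hα : IsHypFixedPt (heckeLambda p) α) :
    (∃ n : ℕ, GpReduced (heckeLambda p) (cq (heckeLambda p) α n)) ∧
    ∀ β : ℝ, GpReduced (heckeLambda p) β →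
      GpReduced (heckeLambda p) (cq (heckeLambda p) β 1) := by
  have hl := heckeLambda_pos hp
  refine ⟨?_, ?_⟩
  · obtain ⟨m, n, hmn, h⟩ := hα.exists_cq_eq hp
    wlog hlt : m < n generalizing m n
    · exact this n m hmn.symm h.symm (by omega)
    · refine ⟨m, hα.cq hl m, n - m, by omega, ?_⟩
      rw [cq_add_s13, Nat.add_sub_cancel' hlt.le, h]
  · rintro β ⟨hβ, m, hm, h⟩
    refine ⟨hβ.cq hl 1, m, hm, ?_⟩
    rw [cq_add_s13, add_comm, ← cq_add_s13, h]
end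
end
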